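/- arXiv:2103.12659 — 3 statements merged into one kernel-verified Lean document; each statement's English description precedes it below -/
import Mathlib

section
/- Let α > 0 and let m = (m_j)_{j≥1} be a sequence of positive integers satisfying m_j = j^{α+o(1)}, i.e. for every δ > 0 one has j^{α−δ} ≤ m_j ≤ j^{α+δ} for all sufficiently large j. For positive integers N, Q define S(m;Q) = { a/m_j : gcd(a, m_j) = 1, 1 ≤ a < m_j, Q ≤ j ≤ 2Q } and M(m;N,Q) = max_{x ∈ S(m;Q)} #{ y ∈ S(m;Q) : ⟨x − y⟩ < 1/(2N) }, where ⟨t⟩ denotes the distance from the real number t to the nearest integer. Then for every ε > 0 there exists a constant C > 0 such that for all positive integers N, Q with Q^α ≤ N ≤ Q^{2α}, one has M(m;N,Q) ≤ C · ( E⁺(m_{2Q})^{1/4} + N^{−1/4} Q^{α/2 + ε} E⁺_⋆(m_{2Q})^{1/4} ). -/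
open scoped BigOperators Classical

/-- The additive energy `E⁺(S)` of a finite set of integers. -/
def addEnergy (S : Finset ℤ) : ℕ :=
  ((S ×ˢ S ×ˢ S ×ˢ S).filter fun x => x.1 + x.2.1 = x.2.2.1 + x.2.2.2).card

/-- The asymmetric additive energy `E⁺_h(S)`. -/
def addEnergyShift (h : ℤ) (S : Finset ℤ) : ℕ :=
  ((S ×ˢ S ×ˢ S ×ˢ S).filter fun x => x.1 + x.2.1 = x.2.2.1 + x.2.2.2 + h).card

/-- `E⁺_⋆(S) = max_{h ≠ 0} E⁺_h(S)`. -/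
noncomputable def addEnergyStar (S : Finset ℤ) : ℕ :=
  sSup {n : ℕ | ∃ h : ℤ, h ≠ 0 ∧ addEnergyShift h S = n}

/-- The set `m_U = {m_1, …, m_U}` of the first `U` elements of the sequence `m`. -/
def seqSet (m : ℕ → ℕ) (U : ℕ) : Finset ℤ :=
  (Finset.Icc 1 U).image fun j => (m j : ℤ)

/-- The set of Farey fractions `a / m_j` with `gcd(a, m_j) = 1`, `1 ≤ a < m_j`,
`Q ≤ j ≤ 2Q`. -/
noncomputable def fareySet (m : ℕ → ℕ) (Q : ℕ) : Finset ℚ :=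
  (Finset.Icc Q (2 * Q)).biUnion fun j =>
    ((Finset.Ico 1 (m j)).filter (fun a : ℕ => Nat.gcd a (m j) = 1)).image
      (fun a => (a : ℚ) / (m j : ℚ))

/-- `⟨t⟩`, the distance from `t` to the nearest integer. -/
noncomputable def distNearestInt (t : ℝ) : ℝ := |t - round t|

theorem shift_le_star (S : Finset ℤ) (h : ℤ) (hh : h ≠ 0) :
    addEnergyShift h S ≤ addEnergyStar S := by
  unfold addEnergyStar
  apply le_csSup
  · refine ⟨(S ×ˢ S ×ˢ S ×ˢ S).card, ?_⟩
    rintro n ⟨h, -, rfl⟩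
    exact Finset.card_filter_le _ _
  · exact ⟨h, hh, rfl⟩

theorem energy_le_cube (S : Finset ℤ) : addEnergy S ≤ S.card ^ 3 := by
  have : addEnergy S ≤ (S ×ˢ S ×ˢ S).card := by
    unfold addEnergy
    apply Finset.card_le_card_of_injOn (fun x => (x.1, x.2.1, x.2.2.1))
    · rintro ⟨a, b, c, d⟩ hx
      simp at hx ⊢
      tauto
    · rintro ⟨a, b, c, d⟩ hx ⟨a', b', c', d'⟩ hy hxy
      simp at hx hy hxy ⊢
      omega
  calc _ ≤ _ := this
    _ = _ := by simp [Finset.card_product]; ring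

theorem energy_pos (S : Finset ℤ) (hS : S.Nonempty) : 1 ≤ addEnergy S := by
  obtain ⟨s, hs⟩ := hS
  unfold addEnergy
  apply Finset.card_pos.mpr
  exact ⟨(s, s, s, s), by simp [hs]⟩

theorem energy_split (S D H : Finset ℤ) (hD : D ⊆ S)
    (hH : ∀ a ∈ D, ∀ b ∈ D, ∀ c ∈ D, ∀ d ∈ D, a + b - c - d ∈ H) :
    D.card ^ 4 ≤ addEnergy S + H.card * addEnergyStar S := by
  have h1 : D ×ˢ D ×ˢ D ×ˢ D ⊆
      ((S ×ˢ S ×ˢ S ×ˢ S).filter fun x => x.1 + x.2.1 = x.2.2.1 + x.2.2.2) ∪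
      (H.filter (fun h => h ≠ 0)).biUnion (fun h =>
        ((S ×ˢ S ×ˢ S ×ˢ S).filter fun x => x.1 + x.2.1 = x.2.2.1 + x.2.2.2 + h)) := by
    rintro ⟨a, b, c, d⟩ hx
    simp only [Finset.mem_product] at hx
    obtain ⟨ha, hb, hc, hd⟩ := hx
    simp only [Finset.mem_union, Finset.mem_biUnion, Finset.mem_filter, Finset.mem_product]
    by_cases h0 : a + b = c + d
    · exact Or.inl ⟨⟨hD ha, hD hb, hD hc, hD hd⟩, h0⟩
    · refine Or.inr ⟨a + b - c - d, ⟨hH a ha b hb c hc d hd, by omega⟩,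
        ⟨hD ha, hD hb, hD hc, hD hd⟩, by ring⟩
  have h2 := (Finset.card_le_card h1).trans (Finset.card_union_le _ _)
  have h3 : ((H.filter (fun h => h ≠ 0)).biUnion (fun h =>
        ((S ×ˢ S ×ˢ S ×ˢ S).filter fun x => x.1 + x.2.1 = x.2.2.1 + x.2.2.2 + h))).card
        ≤ H.card * addEnergyStar S := by
    refine (Finset.card_biUnion_le_card_mul _ _ (addEnergyStar S) ?_).trans
      (Nat.mul_le_mul_right _ (Finset.card_filter_le _ _))
    intro h hh
    exact shift_le_star S h (Finset.mem_filter.mp hh).2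
  have h4 : (D ×ˢ D ×ˢ D ×ˢ D).card = D.card ^ 4 := by
    simp [Finset.card_product]; ring
  rw [← h4]
  exact h2.trans (Nat.add_le_add_left h3 _)

/-- integers in a bounded interval -/
theorem card_int_le (F : Finset ℤ) (lo hi : ℝ) (hlh : lo ≤ hi)
    (hF : ∀ z ∈ F, lo ≤ (z : ℝ) ∧ (z : ℝ) ≤ hi) : (F.card : ℝ) ≤ hi - lo + 1 := by
  have h1 : F ⊆ Finset.Icc ⌈lo⌉ ⌊hi⌋ := by
    intro z hz
    obtain ⟨h1, h2⟩ := hF z hz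
    exact Finset.mem_Icc.mpr ⟨Int.ceil_le.mpr h1, Int.le_floor.mpr h2⟩
  have h2 := Finset.card_le_card h1
  rw [Int.card_Icc] at h2
  have h3 : (F.card : ℝ) ≤ ((⌊hi⌋ + 1 - ⌈lo⌉).toNat : ℝ) := by exact_mod_cast h2
  refine h3.trans ?_
  rcases le_total 0 (⌊hi⌋ + 1 - ⌈lo⌉) with h | h
  · have : ((⌊hi⌋ + 1 - ⌈lo⌉).toNat : ℝ) = ((⌊hi⌋ + 1 - ⌈lo⌉ : ℤ) : ℝ) := by
      exact_mod_cast congrArg (Int.cast (R := ℝ)) (Int.toNat_of_nonneg h)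
    rw [this]
    push_cast
    have := Int.floor_le hi
    have := Int.le_ceil lo
    linarith
  · rw [Int.toNat_of_nonpos h]
    simp; linarith

theorem count_H (H : Finset ℤ) (m : ℕ) (hm : 0 < m) (a : ℤ) (ha : IsCoprime a (m : ℤ))
    (L R : ℝ) (hL : 0 ≤ L) (hR : 0 ≤ R)
    (hH : ∀ h ∈ H, |(h : ℝ)| ≤ L ∧ ∃ r : ℤ, |(r : ℝ)| ≤ R ∧ (m : ℤ) ∣ a * h - r) :
    (H.card : ℝ) ≤ (2 * R + 1) * (2 * (L / m) + 2) := by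
  have hm' : (0 : ℝ) < m := by exact_mod_cast hm
  have hr : ∀ h : ℤ, ∃ r : ℤ, h ∈ H → |(r : ℝ)| ≤ R ∧ (m : ℤ) ∣ a * h - r := by
    intro h
    by_cases hh : h ∈ H
    · obtain ⟨r, hr⟩ := (hH h hh).2
      exact ⟨r, fun _ => hr⟩
    · exact ⟨0, fun h => absurd h hh⟩
  choose r hr using hr
  have h1 : H.card ≤ (H.image r ×ˢ H.image (fun h => h / (m : ℤ))).card := by
    apply Finset.card_le_card_of_injOn (fun h => (r h, h / (m : ℤ)))
    · intro h hh
      simp only [Finset.coe_product, Set.mem_prod, Finset.mem_coe]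
      exact ⟨Finset.mem_image_of_mem r hh, Finset.mem_image_of_mem (fun h => h / (m : ℤ)) hh⟩
    · intro h hh h' hh' he
      simp only [Prod.mk.injEq] at he
      have d1 := (hr h hh).2
      have d2 := (hr h' hh').2
      rw [he.1] at d1
      have d3 : (m : ℤ) ∣ a * (h - h') := by
        have := dvd_sub d1 d2
        have e : a * (h - h') = a * h - r h' - (a * h' - r h') := by ring
        rw [e]; exact this
      have d4 : (m : ℤ) ∣ h - h' := ha.symm.dvd_of_dvd_mul_left d3
      have d5 : h % m = h' % m :=
        Int.emod_eq_emod_iff_emod_sub_eq_zero.mpr (Int.emod_eq_zero_of_dvd d4)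
      rw [← Int.mul_ediv_add_emod h m, ← Int.mul_ediv_add_emod h' m, he.2, d5]
  rw [Finset.card_product] at h1
  have h2 : ((H.image r).card : ℝ) ≤ 2 * R + 1 := by
    have := card_int_le (H.image r) (-R) R (by linarith) (by
      intro z hz
      obtain ⟨h, hh, rfl⟩ := Finset.mem_image.mp hz
      exact abs_le.mp (hr h hh).1)
    linarith
  have h3 : ((H.image (fun h => h / (m : ℤ))).card : ℝ) ≤ 2 * (L / m) + 2 := by
    have := card_int_le (H.image (fun h => h / (m : ℤ))) (-(L / m) - 1) (L / m)
      (by have : 0 ≤ L / m := by positivity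
          linarith) (by
      intro z hz
      obtain ⟨h, hh, rfl⟩ := Finset.mem_image.mp hz
      obtain ⟨b1, b2⟩ := abs_le.mp (hH h hh).1
      have e1 : (m : ℝ) * ((h / (m : ℤ) : ℤ) : ℝ) + ((h % (m : ℤ) : ℤ) : ℝ) = h := by
        exact_mod_cast Int.mul_ediv_add_emod h m
      have e2 : (0 : ℝ) ≤ ((h % (m : ℤ) : ℤ) : ℝ) := by
        exact_mod_cast Int.emod_nonneg h (by omega)
      have e3 : ((h % (m : ℤ) : ℤ) : ℝ) < m := by
        exact_mod_cast Int.emod_lt_of_pos h (by omega)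
      constructor
      · have : -(L / m) - 1 = (-L - m) / m := by field_simp
        rw [this, div_le_iff₀ hm']
        linarith
      · rw [le_div_iff₀ hm']
        linarith)
    linarith
  calc (H.card : ℝ) ≤ (H.image r).card * (H.image (fun h => h / (m : ℤ))).card := by
        exact_mod_cast h1
    _ ≤ _ := by gcongr

theorem rat_num_real (z : ℚ) : (z : ℝ) * z.den = z.num := by
  exact_mod_cast Rat.mul_den_eq_num z

theorem den_pos_real (z : ℚ) : (0 : ℝ) < z.den := by
  exact_mod_cast z.den_pos

/-- Case A. -/
theorem caseA (x : ℚ) (Z : Finset ℚ) (S : Finset ℤ) (N : ℕ) (hN : 0 < N) (P : ℝ)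
    (hxP : (x.den : ℝ) ≤ P) (hPN : P ≤ N)
    (hZ : ∀ z ∈ Z, |(x : ℝ) - z| < 1 / (2 * N) ∧ (z.den : ℤ) ∈ S ∧ (z.den : ℝ) ≤ P) :
    (Z.card : ℝ) ^ 4 ≤ addEnergy S +
      (4 * (P ^ 2 / N) + 1) * (4 * (P / x.den) + 2) * addEnergyStar S := by
  have hN' : (0 : ℝ) < N := by exact_mod_cast hN
  have hx0 := den_pos_real x
  have hP : 0 < P := by linarith
  set D : Finset ℤ := Z.image (fun z => (z.den : ℤ)) with hDdef
  have hcard : D.card = Z.card := by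
    apply Finset.card_image_of_injOn
    intro z hz z' hz' he
    have he' : z.den = z'.den := by
      have he2 : (z.den : ℤ) = z'.den := he
      exact_mod_cast he2
    obtain ⟨h1, -, h3⟩ := hZ z hz
    obtain ⟨h1', -, -⟩ := hZ z' hz'
    have e1 := rat_num_real z
    have e2 := rat_num_real z'
    rw [← he'] at e2
    have hd := den_pos_real z
    have h4 : |(z : ℝ) - z'| < 1 / N := by
      have : (1 : ℝ) / N = 1 / (2 * N) + 1 / (2 * N) := by field_simp; norm_num
      rw [this]
      rw [abs_lt] at *
      constructor <;> linarith
    have h5 : |((z.num - z'.num : ℤ) : ℝ)| < 1 := by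
      push_cast
      rw [← e1, ← e2, ← sub_mul, abs_mul, abs_of_pos hd]
      calc |(z : ℝ) - z'| * z.den < 1 / N * z.den := by gcongr
        _ ≤ 1 / N * N := by exact mul_le_mul_of_nonneg_left (h3.trans hPN) (by positivity)
        _ = 1 := by field_simp
    have h6 : z.num - z'.num = 0 := by
      apply Int.abs_lt_one_iff.mp
      exact_mod_cast h5
    exact Rat.ext (by omega) he'
  have hD : ∀ d ∈ D, (0 : ℝ) ≤ d ∧ (d : ℝ) ≤ P ∧ ∃ r : ℤ, |(r : ℝ)| ≤ P ^ 2 / N / 2 ∧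
      (x.den : ℤ) ∣ x.num * d - r := by
    intro d hd
    obtain ⟨z, hz, rfl⟩ := Finset.mem_image.mp hd
    obtain ⟨h1, -, h3⟩ := hZ z hz
    have hd := den_pos_real z
    refine ⟨by exact_mod_cast hd.le, by exact_mod_cast h3, x.num * z.den - z.num * x.den, ?_, ?_⟩
    · push_cast
      rw [← rat_num_real x, ← rat_num_real z]
      have : (x : ℝ) * x.den * z.den - z * z.den * x.den = (x - z) * (x.den * z.den) := by ring
      rw [this, abs_mul, abs_of_pos (a := (x.den : ℝ) * z.den) (by positivity)]
      calc |(x : ℝ) - z| * (x.den * z.den) ≤ 1 / (2 * N) * (P * P) := by gcongr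
        _ = _ := by field_simp
    · exact ⟨z.num, by ring⟩
  set H : Finset ℤ := (D ×ˢ D ×ˢ D ×ˢ D).image (fun x => x.1 + x.2.1 - x.2.2.1 - x.2.2.2) with hH
  have hs := energy_split S D H (by
      intro d hd
      obtain ⟨z, hz, rfl⟩ := Finset.mem_image.mp hd
      exact (hZ z hz).2.1) (by
      intro a ha b hb c hc d hd
      exact Finset.mem_image.mpr ⟨(a, b, c, d), by simp [ha, hb, hc, hd], rfl⟩)
  have hcop : IsCoprime x.num (x.den : ℤ) := by
    rw [Int.isCoprime_iff_gcd_eq_one]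
    exact x.reduced
  have hc := count_H H x.den x.den_pos x.num hcop (2 * P) (2 * (P ^ 2 / N)) (by positivity)
    (by positivity) (by
      intro h hh
      obtain ⟨⟨a, b, c, d⟩, hq, rfl⟩ := Finset.mem_image.mp hh
      simp only [Finset.mem_product] at hq
      obtain ⟨ha, hb, hc, hd⟩ := hq
      obtain ⟨a0, a1, ra, a2, a3⟩ := hD a ha
      obtain ⟨b0, b1, rb, b2, b3⟩ := hD b hb
      obtain ⟨c0, c1, rc, c2, c3⟩ := hD c hc
      obtain ⟨d0, d1, rd, d2, d3⟩ := hD d hd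
      refine ⟨?_, ra + rb - rc - rd, ?_, ?_⟩
      · push_cast
        rw [abs_le]
        constructor <;> linarith
      · push_cast
        rw [abs_le] at *
        constructor <;> linarith
      · have := dvd_sub (dvd_sub (dvd_add a3 b3) c3) d3
        have e : x.num * (a + b - c - d) - (ra + rb - rc - rd) = x.num * a - ra + (x.num * b - rb)
          - (x.num * c - rc) - (x.num * d - rd) := by ring
        exact e ▸ this)
  rw [hcard] at hs
  have hs' : (Z.card : ℝ) ^ 4 ≤ addEnergy S + H.card * addEnergyStar S := by exact_mod_cast hs
  refine hs'.trans ?_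
  gcongr
  refine hc.trans (le_of_eq ?_)
  ring

/-- Case B. -/
theorem caseB (x : ℚ) (Z : Finset ℚ) (S : Finset ℤ) (N : ℕ) (hN : 0 < N) (P : ℝ)
    (hP : 0 ≤ P) (hPN : N ≤ P) (hS : ∀ s ∈ S, (0 : ℝ) ≤ s ∧ (s : ℝ) ≤ P) (hS2 : 2 ≤ S.card)
    (hZ : ∀ z ∈ Z, |(x : ℝ) - z| < 1 / (2 * N) ∧ (z.den : ℤ) ∈ S) :
    (Z.card : ℝ) ^ 4 ≤ 160 * (P / N) ^ 4 * P * addEnergyStar S := by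
  have hN' : (1 : ℝ) ≤ N := by exact_mod_cast hN
  have hN0 : (0 : ℝ) < N := by linarith
  have hPN1 : 1 ≤ P / N := by rw [le_div_iff₀ hN0]; linarith
  have h1 : (Z.card : ℝ) ≤ S.card * (2 * (P / N)) := by
    have e : Z.card = ∑ s ∈ S, (Z.filter (fun z => (z.den : ℤ) = s)).card :=
      Finset.card_eq_sum_card_fiberwise (fun z hz => (hZ z hz).2)
    rw [e]
    push_cast
    rw [← nsmul_eq_mul]
    apply Finset.sum_le_card_nsmul
    intro s hs
    set F := Z.filter (fun z => (z.den : ℤ) = s) with hF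
    have hc : (F.image (fun z => z.num)).card = F.card := by
      apply Finset.card_image_of_injOn
      intro z hz z' hz' he
      simp only [hF, Finset.coe_filter, Set.mem_ofPred_eq] at hz hz'
      refine Rat.ext he ?_
      have := hz.2.trans hz'.2.symm
      exact_mod_cast this
    rw [← hc]
    obtain ⟨s0, sP⟩ := hS s hs
    have := card_int_le (F.image (fun z => z.num)) (x * s - s / (2 * N)) (x * s + s / (2 * N))
      (by have : (0 : ℝ) ≤ s / (2 * N) := by positivity
          linarith) (by
        intro p hp
        obtain ⟨z, hz, rfl⟩ := Finset.mem_image.mp hp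
        simp only [hF, Finset.mem_filter] at hz
        obtain ⟨hz, rfl⟩ := hz
        obtain ⟨h1, -⟩ := hZ z hz
        have hd := den_pos_real z
        rw [← rat_num_real z]
        push_cast
        rw [abs_lt] at h1
        have e : (z.den : ℝ) / (2 * N) = 1 / (2 * N) * z.den := by ring
        rw [e]
        constructor <;> nlinarith)
    have e2 : (s : ℝ) / (2 * N) ≤ P / N / 2 := by
      rw [div_div, mul_comm (N : ℝ) 2]
      gcongr
    linarith
  set H : Finset ℤ := (S ×ˢ S ×ˢ S ×ˢ S).image (fun x => x.1 + x.2.1 - x.2.2.1 - x.2.2.2) with hH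
  have hs := energy_split S S H (subset_refl _) (by
      intro a ha b hb c hc d hd
      exact Finset.mem_image.mpr ⟨(a, b, c, d), by simp [ha, hb, hc, hd], rfl⟩)
  have hc := card_int_le H (-(2 * P)) (2 * P) (by linarith) (by
      intro h hh
      obtain ⟨⟨a, b, c, d⟩, hq, rfl⟩ := Finset.mem_image.mp hh
      simp only [Finset.mem_product] at hq
      obtain ⟨ha, hb, hc, hd⟩ := hq
      have := hS a ha
      have := hS b hb
      have := hS c hc
      have := hS d hd
      push_cast
      constructor <;> linarith)
  have hs' : (S.card : ℝ) ^ 4 ≤ addEnergy S + H.card * addEnergyStar S := by exact_mod_cast hs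
  have hcube : (addEnergy S : ℝ) ≤ (S.card : ℝ) ^ 3 := by exact_mod_cast energy_le_cube S
  have hS2' : (2 : ℝ) ≤ S.card := by exact_mod_cast hS2
  have h5 : (H.card : ℝ) * addEnergyStar S ≤ 5 * P * addEnergyStar S := by
    gcongr
    linarith
  have h6 : (S.card : ℝ) ^ 4 ≤ 10 * P * addEnergyStar S := by
    have : 2 * (S.card : ℝ) ^ 3 ≤ (S.card : ℝ) ^ 4 := by
      rw [pow_succ (S.card : ℝ) 3, mul_comm]
      gcongr
    linarith
  calc (Z.card : ℝ) ^ 4 ≤ (S.card * (2 * (P / N))) ^ 4 := by gcongr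
    _ = 16 * (P / N) ^ 4 * (S.card : ℝ) ^ 4 := by ring
    _ ≤ 16 * (P / N) ^ 4 * (10 * P * addEnergyStar S) := by gcongr
    _ = _ := by ring

/-- Both cases, in terms of `u = Q^α`, `v = Q^δ`. -/
theorem combined (x : ℚ) (Z : Finset ℚ) (S : Finset ℤ) (N : ℕ) (hN : 0 < N) (c u v : ℝ)
    (hc : 1 ≤ c) (hu : 1 ≤ u) (hv : 1 ≤ v) (huN : u ≤ N) (hNu : (N : ℝ) ≤ u ^ 2)
    (hxl : u / v ≤ x.den)
    (hxS : (x.den : ℤ) ∈ S) (hS : ∀ s ∈ S, (0 : ℝ) ≤ s ∧ (s : ℝ) ≤ c * u * v) (hS2 : 2 ≤ S.card)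
    (hZ : ∀ z ∈ Z, |(x : ℝ) - z| < 1 / (2 * N) ∧ (z.den : ℤ) ∈ S) :
    (Z.card : ℝ) ^ 4 ≤ 160 * c ^ 6 * (addEnergy S + u ^ 2 * v ^ 8 / N * addEnergyStar S) := by
  have hN0 : (0 : ℝ) < N := by exact_mod_cast hN
  have hP0 : 0 < c * u * v := by positivity
  have hx0 := den_pos_real x
  have hxP : (x.den : ℝ) ≤ c * u * v := by exact_mod_cast (hS _ hxS).2
  rcases le_total (c * u * v) N with h | h
  · refine (caseA x Z S N hN (c * u * v) hxP h ?_).trans ?_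
    · intro z hz
      obtain ⟨h1, h2⟩ := hZ z hz
      exact ⟨h1, h2, by exact_mod_cast (hS _ h2).2⟩
    · have k1 : 1 ≤ (c * u * v) ^ 2 / N := by
        rw [le_div_iff₀ hN0, one_mul]
        refine hNu.trans ?_
        gcongr
        have : 1 ≤ c * v := one_le_mul_of_one_le_of_one_le hc hv
        nlinarith
      have k2 : 1 ≤ c * u * v / x.den := by
        rw [le_div_iff₀ hx0, one_mul]; exact hxP
      have k3 : c * u * v / x.den ≤ c * v ^ 2 := by
        rw [div_le_iff₀ hx0]
        calc c * u * v = c * v ^ 2 * (u / v) := by field_simp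
          _ ≤ _ := by gcongr
      have k4 : (4 * ((c * u * v) ^ 2 / N) + 1) * (4 * (c * u * v / x.den) + 2)
          ≤ 160 * c ^ 6 * (u ^ 2 * v ^ 8 / N) := by
        calc (4 * ((c * u * v) ^ 2 / N) + 1) * (4 * (c * u * v / x.den) + 2)
            ≤ (5 * ((c * u * v) ^ 2 / N)) * (6 * (c * v ^ 2)) := by
              gcongr <;> linarith
          _ = 30 * c ^ 3 * (u ^ 2 * v ^ 4 / N) := by ring
          _ ≤ _ := by
              gcongr <;> norm_num <;> assumption
      have k5 : (1 : ℝ) ≤ 160 * c ^ 6 := by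
        have := one_le_pow₀ hc (n := 6)
        linarith
      rw [mul_add (160 * c ^ 6), ← mul_assoc]
      refine add_le_add ?_ (mul_le_mul_of_nonneg_right k4 (Nat.cast_nonneg _))
      exact le_mul_of_one_le_left (by positivity) k5
  · refine (caseB x Z S N hN (c * u * v) hP0.le h hS hS2 hZ).trans ?_
    have k1 : c * u * v / N ≤ c * v := by
      rw [div_le_iff₀ hN0]
      nlinarith [mul_le_mul_of_nonneg_left huN (show 0 ≤ c * v by positivity)]
    have k2 : u * v ^ 7 / c ≤ u ^ 2 * v ^ 8 / N := by
      rw [div_le_div_iff₀ (by positivity) hN0]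
      calc u * v ^ 7 * N ≤ u * v ^ 7 * (c * u * v) := by gcongr
        _ = _ := by ring
    have k3 : 160 * (c * u * v / N) ^ 4 * (c * u * v) ≤ 160 * c ^ 6 * (u ^ 2 * v ^ 8 / N) := by
      calc 160 * (c * u * v / N) ^ 4 * (c * u * v) ≤ 160 * (c * v) ^ 4 * (c * u * v) := by gcongr
        _ = 160 * c ^ 6 * (u * v ^ 5 / c) := by field_simp
        _ ≤ 160 * c ^ 6 * (u * v ^ 7 / c) := by
            gcongr <;> norm_num <;> assumption
        _ ≤ _ := by gcongr
    rw [mul_add, ← mul_assoc]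
    have : (0 : ℝ) ≤ 160 * c ^ 6 * addEnergy S := by positivity
    have := mul_le_mul_of_nonneg_right k3 (Nat.cast_nonneg (α := ℝ) (addEnergyStar S))
    linarith

theorem mem_farey (m : ℕ → ℕ) (hm_pos : ∀ j, 0 < m j) (Q : ℕ) (y : ℚ) (hy : y ∈ fareySet m Q) :
    0 < y ∧ y < 1 ∧ ∃ j, Q ≤ j ∧ j ≤ 2 * Q ∧ y.den = m j := by
  simp only [fareySet, Finset.mem_biUnion, Finset.mem_image, Finset.mem_filter, Finset.mem_Icc,
    Finset.mem_Ico, Finset.bind_def, Finset.pure_def, Finset.mem_sup, Finset.mem_singleton] at hy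
  obtain ⟨j, ⟨hj1, hj2⟩, b, ⟨a, ⟨⟨ha1, ha2⟩, hg⟩, rfl⟩, rfl⟩ := hy
  have hm : (0 : ℚ) < m j := by exact_mod_cast hm_pos j
  have ha : (0 : ℚ) < a := by exact_mod_cast ha1
  refine ⟨by positivity, ?_, j, hj1, hj2, ?_⟩
  · rw [div_lt_one hm]; exact_mod_cast ha2
  · have := Rat.den_div_eq_of_coprime (a := (a : ℤ)) (b := (m j : ℤ)) (by exact_mod_cast hm_pos j)
      (by simpa using hg)
    simp only [Int.cast_natCast] at this
    exact Int.ofNat_injective this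

/-- Unfold the circle around `x`. -/
theorem unfold_circle (Y : Finset ℚ) (x : ℚ) (N : ℝ)
    (hY : ∀ y ∈ Y, 0 < y ∧ y < 1 ∧ distNearestInt ((x : ℝ) - (y : ℝ)) < 1 / (2 * N)) :
    ∃ Z : Finset ℚ, Z.card = Y.card ∧
      ∀ z ∈ Z, |(x : ℝ) - z| < 1 / (2 * N) ∧ ∃ y ∈ Y, z.den = y.den := by
  refine ⟨Y.image (fun y : ℚ => y + ((round ((x : ℝ) - (y : ℝ)) : ℤ) : ℚ)), ?_, ?_⟩
  · apply Finset.card_image_of_injOn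
    intro y hy y' hy' he
    obtain ⟨h1, h2, -⟩ := hY y hy
    obtain ⟨h1', h2', -⟩ := hY y' hy'
    simp only at he
    set k := round ((x : ℝ) - (y : ℝ))
    set k' := round ((x : ℝ) - (y' : ℝ))
    have a1 : ((k - k' : ℤ) : ℚ) < 1 := by push_cast; linarith
    have a2 : (-1 : ℚ) < ((k - k' : ℤ) : ℚ) := by push_cast; linarith
    have a1' : k - k' < 1 := by exact_mod_cast a1
    have a2' : -1 < k - k' := by exact_mod_cast a2
    have : k = k' := by omega
    rw [this] at he
    linarith
  · intro z hz
    obtain ⟨y, hy, rfl⟩ := Finset.mem_image.mp hz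
    refine ⟨?_, y, hy, ?_⟩
    · have := (hY y hy).2.2
      unfold distNearestInt at this
      push_cast
      rw [← sub_sub]
      exact this
    · exact Rat.add_intCast_den y _

/-- Consequences of the growth hypothesis. -/
theorem growth_facts (α δ : ℝ) (hδ : 0 < δ) (hδα : δ < α) (m : ℕ → ℕ)
    (hm_growth : ∀ δ : ℝ, 0 < δ → ∃ J : ℕ, ∀ j : ℕ, J ≤ j →
      (j : ℝ) ^ (α - δ) ≤ (m j : ℝ) ∧ (m j : ℝ) ≤ (j : ℝ) ^ (α + δ)) :
    ∃ Q0 : ℕ, 1 ≤ Q0 ∧ ∀ Q : ℕ, Q0 ≤ Q →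
      (∀ j, Q ≤ j → (Q : ℝ) ^ (α - δ) ≤ m j) ∧
      (∀ s ∈ seqSet m (2 * Q), (0 : ℝ) ≤ s ∧ (s : ℝ) ≤ ((2 * Q : ℕ) : ℝ) ^ (α + δ)) ∧
      2 ≤ (seqSet m (2 * Q)).card := by
  obtain ⟨J, hJ⟩ := hm_growth δ hδ
  have t1 : Filter.Tendsto (fun n : ℕ => (n : ℝ) ^ (α + δ)) Filter.atTop Filter.atTop :=
    (tendsto_rpow_atTop (by linarith)).comp tendsto_natCast_atTop_atTop
  have t2 : Filter.Tendsto (fun n : ℕ => (n : ℝ) ^ (α - δ)) Filter.atTop Filter.atTop :=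
    (tendsto_rpow_atTop (by linarith)).comp tendsto_natCast_atTop_atTop
  obtain ⟨K1, hK1⟩ := Filter.eventually_atTop.mp
    (t1.eventually_ge_atTop ((∑ j ∈ Finset.range J, m j : ℕ) : ℝ))
  obtain ⟨K2, hK2⟩ := Filter.eventually_atTop.mp (t2.eventually_gt_atTop (m 1 : ℝ))
  refine ⟨J + K1 + K2 + 1, by omega, fun Q hQ => ⟨?_, ?_, ?_⟩⟩
  · intro j hj
    refine le_trans ?_ (hJ j (by omega)).1
    apply Real.rpow_le_rpow (by positivity) (by exact_mod_cast hj) (by linarith)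
  · intro s hs
    simp only [seqSet, Finset.mem_image, Finset.mem_Icc] at hs
    obtain ⟨j, ⟨hj1, hj2⟩, rfl⟩ := hs
    refine ⟨by positivity, ?_⟩
    push_cast [-Nat.cast_mul]
    by_cases hj : J ≤ j
    · refine (hJ j hj).2.trans ?_
      apply Real.rpow_le_rpow (by positivity) (by exact_mod_cast hj2) (by linarith)
    · refine le_trans ?_ (hK1 (2 * Q) (by omega))
      have : m j ≤ ∑ j ∈ Finset.range J, m j :=
        Finset.single_le_sum (f := m) (fun _ _ => Nat.zero_le _) (Finset.mem_range.mpr (by omega))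
      exact_mod_cast this
  · have h1 : m 1 < m Q := by
      have := (hK2 Q (by omega)).trans_le (hJ Q (by omega)).1
      exact_mod_cast this
    have : ({(m 1 : ℤ), (m Q : ℤ)} : Finset ℤ) ⊆ seqSet m (2 * Q) := by
      intro s hs
      simp only [Finset.mem_insert, Finset.mem_singleton] at hs
      simp only [seqSet, Finset.mem_image, Finset.mem_Icc]
      rcases hs with rfl | rfl
      · exact ⟨1, by omega, rfl⟩
      · exact ⟨Q, by omega, rfl⟩
    have h2 := Finset.card_le_card this
    rwa [Finset.card_pair (by omega)] at h2

theorem farey_spacing_via_energy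
    (α : ℝ) (hα : 0 < α) (m : ℕ → ℕ) (hm_pos : ∀ j, 0 < m j)
    (hm_growth : ∀ δ : ℝ, 0 < δ → ∃ J : ℕ, ∀ j : ℕ, J ≤ j →
      (j : ℝ) ^ (α - δ) ≤ (m j : ℝ) ∧ (m j : ℝ) ≤ (j : ℝ) ^ (α + δ))
    (ε : ℝ) (hε : 0 < ε) :
    ∃ C : ℝ, 0 < C ∧ ∀ N Q : ℕ, 0 < N → 0 < Q →
      (Q : ℝ) ^ α ≤ (N : ℝ) → (N : ℝ) ≤ (Q : ℝ) ^ (2 * α) →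
      ∀ x ∈ fareySet m Q,
      (((fareySet m Q).filter
          (fun y : ℚ => distNearestInt ((x : ℝ) - (y : ℝ)) < 1 / (2 * (N : ℝ)))).card : ℝ)
        ≤ C * ((addEnergy (seqSet m (2 * Q)) : ℝ) ^ ((1 : ℝ) / 4)
               + (N : ℝ) ^ (-(1 : ℝ) / 4) * (Q : ℝ) ^ (α / 2 + ε)
                 * (addEnergyStar (seqSet m (2 * Q)) : ℝ) ^ ((1 : ℝ) / 4)) := by
  set δ : ℝ := min (ε / 2) (α / 2) with hδdef
  have hδ : 0 < δ := by positivity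
  have hδα : δ < α := (min_le_right _ _).trans_lt (by linarith)
  have hδε : δ ≤ ε / 2 := min_le_left _ _
  obtain ⟨Q0, hQ0, hgrow⟩ := growth_facts α δ hδ hδα m hm_growth
  set c : ℝ := (2 : ℝ) ^ (α + δ) with hcdef
  have hc : 1 ≤ c := Real.one_le_rpow (by norm_num) (by linarith)
  have hc6 := one_le_pow₀ hc (n := 6)
  obtain ⟨C0, hC0⟩ : ∃ C0 : ℕ, C0 = ∑ q ∈ Finset.range Q0, (fareySet m q).card := ⟨_, rfl⟩
  have hC0' : (0 : ℝ) ≤ C0 := Nat.cast_nonneg _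
  refine ⟨160 * c ^ 6 + C0, by positivity, ?_⟩
  intro N Q hN hQ hNl hNu x hx
  set S := seqSet m (2 * Q) with hS
  set Y := (fareySet m Q).filter
          (fun y : ℚ => distNearestInt ((x : ℝ) - (y : ℝ)) < 1 / (2 * (N : ℝ))) with hYdef
  set A : ℝ := (addEnergy S : ℝ) ^ ((1 : ℝ) / 4) with hA
  set B : ℝ := (N : ℝ) ^ (-(1 : ℝ) / 4) * (Q : ℝ) ^ (α / 2 + ε)
                 * (addEnergyStar S : ℝ) ^ ((1 : ℝ) / 4) with hB
  have hA0 : 0 ≤ A := by positivity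
  have hB0 : 0 ≤ B := by positivity
  have hQ1 : (1 : ℝ) ≤ Q := by exact_mod_cast hQ
  have hQp : (0 : ℝ) < Q := by linarith
  have hNp : (0 : ℝ) < N := by exact_mod_cast hN
  by_cases hQQ : Q < Q0
  · have hSne : S.Nonempty := ⟨(m 1 : ℤ), by
      simp only [hS, seqSet, Finset.mem_image, Finset.mem_Icc]
      exact ⟨1, by omega, rfl⟩⟩
    have hA1 : 1 ≤ A := Real.one_le_rpow (by exact_mod_cast energy_pos S hSne) (by norm_num)
    have hY : (Y.card : ℝ) ≤ C0 := by
      have h1 : Y.card ≤ (fareySet m Q).card := Finset.card_filter_le _ _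
      have h2 : (fareySet m Q).card ≤ ∑ q ∈ Finset.range Q0, (fareySet m q).card :=
        Finset.single_le_sum (f := fun q => (fareySet m q).card) (fun _ _ => Nat.zero_le _)
          (Finset.mem_range.mpr hQQ)
      rw [← hC0] at h2
      exact_mod_cast h1.trans h2
    calc (Y.card : ℝ) ≤ C0 * 1 := by linarith
      _ ≤ (160 * c ^ 6 + C0) * (A + B) := by
        gcongr
        · linarith
        · linarith
  · obtain ⟨g1, g2, g3⟩ := hgrow Q (by omega)
    obtain ⟨Z, hZc, hZ⟩ := unfold_circle Y x N (by
      intro y hy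
      obtain ⟨hy1, hy2⟩ := Finset.mem_filter.mp hy
      obtain ⟨k1, k2, -⟩ := mem_farey m hm_pos Q y hy1
      exact ⟨k1, k2, hy2⟩)
    have hden : ∀ y ∈ fareySet m Q, (y.den : ℤ) ∈ S := by
      intro y hy
      obtain ⟨-, -, j, j1, j2, j3⟩ := mem_farey m hm_pos Q y hy
      simp only [hS, seqSet, Finset.mem_image, Finset.mem_Icc]
      exact ⟨j, by omega, by rw [j3]⟩
    have hPeq : ((2 * Q : ℕ) : ℝ) ^ (α + δ) = c * (Q : ℝ) ^ α * (Q : ℝ) ^ δ := by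
      push_cast
      rw [Real.mul_rpow (by norm_num) hQp.le, Real.rpow_add hQp, hcdef]
      ring
    have key := combined x Z S N hN c ((Q : ℝ) ^ α) ((Q : ℝ) ^ δ) hc
      (Real.one_le_rpow hQ1 hα.le) (Real.one_le_rpow hQ1 hδ.le) hNl
      (by rwa [← Real.rpow_natCast, ← Real.rpow_mul hQp.le, mul_comm α, Nat.cast_ofNat])
      (by
        obtain ⟨-, -, j, j1, j2, j3⟩ := mem_farey m hm_pos Q x hx
        rw [← Real.rpow_sub hQp, j3]
        exact g1 j j1)
      (hden x hx) (by rw [← hPeq]; exact g2) g3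
      (by
        intro z hz
        obtain ⟨h1, y, hy, h2⟩ := hZ z hz
        refine ⟨h1, ?_⟩
        rw [h2]
        exact hden y (Finset.mem_filter.mp hy).1)
    rw [hZc] at key
    have hA4 : A ^ 4 = addEnergy S := by
      rw [hA, ← Real.rpow_natCast, ← Real.rpow_mul (by positivity)]
      norm_num
    have hB4 : B ^ 4 = (Q : ℝ) ^ (2 * α + 4 * ε) / N * addEnergyStar S := by
      rw [hB, mul_pow, mul_pow]
      simp only [← Real.rpow_natCast]
      rw [← Real.rpow_mul (by positivity), ← Real.rpow_mul (by positivity),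
        ← Real.rpow_mul (by positivity)]
      have e1 : -(1 : ℝ) / 4 * ((4 : ℕ) : ℝ) = -1 := by norm_num
      have e2 : (α / 2 + ε) * ((4 : ℕ) : ℝ) = 2 * α + 4 * ε := by push_cast; ring
      have e3 : (1 : ℝ) / 4 * ((4 : ℕ) : ℝ) = 1 := by norm_num
      rw [e1, e2, e3, Real.rpow_neg_one, Real.rpow_one]
      ring
    have huv : ((Q : ℝ) ^ α) ^ 2 * ((Q : ℝ) ^ δ) ^ 8 ≤ (Q : ℝ) ^ (2 * α + 4 * ε) := by
      simp only [← Real.rpow_natCast]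
      rw [← Real.rpow_mul hQp.le, ← Real.rpow_mul hQp.le, ← Real.rpow_add hQp]
      apply Real.rpow_le_rpow_of_exponent_le hQ1
      push_cast
      linarith
    have key2 : (Y.card : ℝ) ^ 4 ≤ 160 * c ^ 6 * (A ^ 4 + B ^ 4) := by
      refine key.trans ?_
      rw [hA4, hB4]
      refine mul_le_mul_of_nonneg_left (add_le_add le_rfl ?_) (by linarith)
      exact mul_le_mul_of_nonneg_right (div_le_div_of_nonneg_right huv hNp.le) (Nat.cast_nonneg _)
    have hC1 : (1 : ℝ) ≤ 160 * c ^ 6 := by linarith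
    have key3 : (Y.card : ℝ) ^ 4 ≤ (160 * c ^ 6 * (A + B)) ^ 4 := by
      refine key2.trans ?_
      rw [mul_pow (160 * c ^ 6) (A + B)]
      apply mul_le_mul _ _ (by positivity) (by positivity)
      · exact le_self_pow₀ hC1 (by norm_num)
      · have : (A + B) ^ 4 = A ^ 4 + B ^ 4 + (4 * A ^ 3 * B + 6 * A ^ 2 * B ^ 2 + 4 * A * B ^ 3) := by
          ring
        rw [this]
        have : 0 ≤ 4 * A ^ 3 * B + 6 * A ^ 2 * B ^ 2 + 4 * A * B ^ 3 := by positivity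
        linarith
    have key4 := le_of_pow_le_pow_left₀ (by norm_num) (by positivity) key3
    refine key4.trans ?_
    gcongr
    linarith
end

section
/- Let f(T) ∈ ℤ[T] be a polynomial of degree k ≥ 2 with positive leading coefficient and with f(q) ≥ 1 for every positive integer q, and set κ = 2^{k−1}. For positive integers N, Q define S̃_f(Q) = { a/f(q) : gcd(a, f(q)) = 1, 1 ≤ a < f(q), Q ≤ q ≤ 2Q } and M̃_f(N,Q) = max_{x ∈ S̃_f(Q)} #{ y ∈ S̃_f(Q) : ⟨x − y⟩ < 1/(2N) }, where ⟨t⟩ denotes the distance from the real number t to the nearest integer. Then for every ε > 0 there exists a constant C > 0 (depending on f and ε) such that for all positive integers N, Q with Q^k ≤ N ≤ Q^{2k}, one has M̃_f(N,Q) ≤ C · ( Q^{k+1} N^{−1} + Q^{1−1/κ+ε} + Q^{1+k/κ+ε} N^{−1/κ} ). -/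
open scoped BigOperators Classical

/-- The set of Farey fractions `a / f(q)` with `gcd(a, f(q)) = 1`, `1 ≤ a < f(q)`,
`Q ≤ q ≤ 2Q`. -/
noncomputable def fareySetPoly (f : Polynomial ℤ) (Q : ℕ) : Finset ℚ :=
  (Finset.Icc Q (2 * Q)).biUnion fun q =>
    (((Finset.Ico 1 (f.eval (q : ℤ)).toNat : Finset ℕ)).filter
        (fun a : ℕ => Int.gcd (a : ℤ) (f.eval (q : ℤ)) = 1)).image
      (fun a => (a : ℚ) / ((f.eval (q : ℤ) : ℤ) : ℚ))

lemma divisor_bound (ε : ℝ) (hε : 0 < ε) :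
    ∃ C : ℝ, 1 ≤ C ∧ ∀ n : ℕ, n ≠ 0 → (n.divisors.card : ℝ) ≤ C * (n : ℝ) ^ ε := by
  have hl : 0 < Real.log 2 := Real.log_pos (by norm_num)
  set K : ℝ := 1 + 1 / (ε * Real.log 2) with hK
  have hK1 : 1 ≤ K := by rw [hK]; have : 0 < 1 / (ε * Real.log 2) := by positivity
                         linarith
  obtain ⟨P, hP⟩ := exists_nat_ge ((2 : ℝ) ^ (1 / ε))
  have h2 : ∀ v : ℕ, ((v : ℝ) + 1) ≤ K * (2 : ℝ) ^ (ε * v) := by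
    intro v
    have h1 : (2 : ℝ) ^ (ε * v) = Real.exp (Real.log 2 * (ε * v)) := by
      rw [Real.rpow_def_of_pos (by norm_num)]
    have h3 := Real.add_one_le_exp (Real.log 2 * (ε * v))
    rw [h1]
    have h4 : K * (Real.log 2 * (ε * v) + 1) = v + 1 + Real.log 2 * (ε * v) + 1 / (ε * Real.log 2) := by
      rw [hK]; field_simp; ring
    have h5 : 0 ≤ Real.log 2 * (ε * v) := by positivity
    have h6 : 0 < 1 / (ε * Real.log 2) := by positivity
    nlinarith [mul_le_mul_of_nonneg_left h3 (by linarith : (0:ℝ) ≤ K)]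
  have key : ∀ p v : ℕ, p.Prime → ((v : ℝ) + 1) ≤ (if p < P then K else 1) * ((p : ℝ) ^ v) ^ ε := by
    intro p v hp
    have hp0 : (0 : ℝ) ≤ p := by positivity
    have hp2 : (2 : ℝ) ≤ p := by exact_mod_cast hp.two_le
    have e1 : ((p : ℝ) ^ v) ^ ε = (p : ℝ) ^ (ε * v) := by
      rw [← Real.rpow_natCast, ← Real.rpow_mul hp0, mul_comm (v : ℝ)]
    rw [e1]
    split_ifs with h
    · refine (h2 v).trans ?_
      gcongr
    · have h3 : (2 : ℝ) ^ (1 / ε) ≤ p := hP.trans (by exact_mod_cast not_lt.mp h)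
      have h4 : (2 : ℝ) ≤ (p : ℝ) ^ ε := by
        calc (2 : ℝ) = ((2 : ℝ) ^ (1 / ε)) ^ ε := by
              rw [← Real.rpow_mul (by norm_num)]; field_simp; simp
          _ ≤ _ := by gcongr
      rw [one_mul, Real.rpow_mul hp0, Real.rpow_natCast]
      calc (v : ℝ) + 1 ≤ 2 ^ v := by exact_mod_cast Nat.lt_two_pow_self
        _ ≤ _ := by gcongr
  refine ⟨K ^ P, one_le_pow₀ hK1, fun n hn => ?_⟩
  have hprod : (n : ℝ) ^ ε = ∏ p ∈ n.primeFactors, ((p : ℝ) ^ n.factorization p) ^ ε := by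
    rw [Real.finsetProd_rpow _ _ (fun i _ => by positivity)]
    congr 1
    conv_lhs => rw [← Nat.prod_factorization_pow_eq_self hn]
    simp [Finsupp.prod]
  rw [Nat.card_divisors hn, hprod]
  push_cast
  calc _ ≤ ∏ p ∈ n.primeFactors, ((if p < P then K else 1) * ((p : ℝ) ^ n.factorization p) ^ ε) := by
        apply Finset.prod_le_prod
        · intros; positivity
        · intro p hp; exact key p _ (Nat.prime_of_mem_primeFactors hp)
    _ = (∏ p ∈ n.primeFactors, (if p < P then K else 1)) * _ := Finset.prod_mul_distrib
    _ ≤ _ := by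
        apply mul_le_mul_of_nonneg_right _ (Finset.prod_nonneg fun i _ => by positivity)
        rw [← Finset.prod_filter, Finset.prod_const]
        apply pow_le_pow_right₀ hK1
        calc _ ≤ (Finset.range P).card := by
              apply Finset.card_le_card
              intro p hp
              simp at hp ⊢
              exact hp.2
          _ = P := by simp

noncomputable def T (Q : ℕ) : ℕ → ℝ → ℝ → ℕ
  | 0, β, η => if distNearestInt β ≤ η then 1 else 0
  | d + 1, β, η => ∑ h ∈ Finset.Icc (-(Q : ℤ)) Q, T Q d (β * h) η

lemma dni_sub (s t : ℝ) : distNearestInt (s - t) ≤ distNearestInt s + distNearestInt t := by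
  unfold distNearestInt
  calc |s - t - round (s - t)| ≤ |s - t - ((round s - round t : ℤ) : ℝ)| := round_le _ _
    _ = |(s - round s) - (t - round t)| := by push_cast; congr 1; ring
    _ ≤ _ := abs_sub _ _

lemma cardIcc (Q : ℕ) : (Finset.Icc (-(Q : ℤ)) Q).card = 2 * Q + 1 := by
  simp; omega

lemma taylor_diff (g : Polynomial ℝ) (d : ℕ) (hg : g.natDegree ≤ d + 1) (h : ℝ) :
    (Polynomial.taylor h g - g).natDegree ≤ d ∧
    (Polynomial.taylor h g - g).coeff d = (d + 1) * g.coeff (d + 1) * h := by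
  constructor
  · rw [Polynomial.natDegree_le_iff_coeff_eq_zero]
    intro n hn
    rw [Polynomial.coeff_sub, Polynomial.taylor_coeff,
      Polynomial.eval_eq_sum_range' (n := 1), Finset.sum_range_one, Polynomial.hasseDeriv_coeff]
    · simp
    · refine lt_of_le_of_lt (Polynomial.natDegree_hasseDeriv_le _ _) (by omega)
  · rw [Polynomial.coeff_sub, Polynomial.taylor_coeff,
      Polynomial.eval_eq_sum_range' (n := 2), Finset.sum_range_succ, Finset.sum_range_one,
      Polynomial.hasseDeriv_coeff, Polynomial.hasseDeriv_coeff]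
    · simp [add_comm 1 d, Nat.choose_succ_self_right]
    · refine lt_of_le_of_lt (Polynomial.natDegree_hasseDeriv_le _ _) (by omega)

lemma weyl (Q : ℕ) (d : ℕ) : ∀ (g : Polynomial ℝ) (δ : ℝ) (R : Finset ℤ),
    g.natDegree ≤ d + 1 → (∀ r ∈ R, ∀ s ∈ R, s - r ∈ Finset.Icc (-(Q : ℤ)) Q) →
    (∀ r ∈ R, distNearestInt (g.eval (r : ℝ)) ≤ δ) →
    R.card ^ (2 ^ d) ≤ (2 * Q + 1) ^ (2 ^ d - (d + 1)) *
      T Q (d + 1) (((d + 1).factorial : ℝ) * g.coeff (d + 1)) (2 ^ (d + 1) * δ) := by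
  induction d with
  | zero =>
    intro g δ R hg hR hδ
    rcases R.eq_empty_or_nonempty with rfl | ⟨r0, hr0⟩
    · simp
    simp only [T, pow_zero, pow_one, zero_add, Nat.factorial_one, Nat.cast_one, one_mul,
      Nat.sub_self]
    rw [← Finset.card_filter]
    refine Finset.card_le_card_of_injOn (fun r => r - r0) ?_ ?_
    · intro r hr
      simp only [Finset.coe_filter, Set.mem_ofPred_eq]
      refine ⟨hR _ hr0 _ hr, ?_⟩
      have e : g.coeff 1 * ((r - r0 : ℤ) : ℝ) = g.eval (r : ℝ) - g.eval (r0 : ℝ) := by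
        rw [Polynomial.eval_eq_sum_range' (n := 2) (by omega), 
          Polynomial.eval_eq_sum_range' (n := 2) (by omega)]
        simp [Finset.sum_range_succ]; ring
      rw [e]
      have := dni_sub (g.eval (r : ℝ)) (g.eval (r0 : ℝ))
      linarith [hδ r hr, hδ r0 hr0]
    · intro a _ b _ h
      simpa using h
  | succ d ih =>
    intro g δ R hg hR hδ
    set I := Finset.Icc (-(Q : ℤ)) Q with hI
    let S : ℤ → Finset ℤ := fun h => R.filter (fun r => r + h ∈ R)
    have h1 : R.card ^ 2 = ∑ h ∈ I, (S h).card := by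
      rw [sq, ← Finset.card_product]
      rw [Finset.card_eq_sum_card_fiberwise (f := fun p : ℤ × ℤ => p.2 - p.1) (t := I)]
      · apply Finset.sum_congr rfl
        intro h _
        refine Finset.card_bij (fun p _ => p.1) ?_ ?_ ?_
        · rintro ⟨a, b⟩ hp
          simp only [Finset.mem_filter, Finset.mem_product, S] at hp ⊢
          refine ⟨hp.1.1, ?_⟩
          rw [← hp.2]; simpa using hp.1.2
        · rintro ⟨a, b⟩ hp ⟨a', b'⟩ hp' h
          simp only [Finset.mem_filter, Finset.mem_product] at hp hp' h
          ext
          · exact h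
          · simp only; omega
        · intro b hb
          simp only [Finset.mem_filter, S] at hb
          exact ⟨(b, b + h), by simp [hb], rfl⟩
      · rintro ⟨a, b⟩ hp
        simp only [Finset.coe_product, Set.mem_prod, Finset.mem_coe] at hp
        exact hR a hp.1 b hp.2
    have h2 : ∀ h ∈ I, (S h).card ^ (2 ^ d) ≤ (2 * Q + 1) ^ (2 ^ d - (d + 1)) *
        T Q (d + 1) ((((d + 2).factorial : ℝ) * g.coeff (d + 2)) * h) (2 ^ (d + 2) * δ) := by
      intro h _
      obtain ⟨t1, t2⟩ := taylor_diff g (d + 1) hg (h : ℝ)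
      have := ih (Polynomial.taylor (h : ℝ) g - g) (2 * δ) (S h) t1 ?_ ?_
      · rw [t2] at this
        convert this using 3
        · rw [Nat.factorial_succ (d + 1)]; push_cast; ring
        · ring
      · intro r hr s hs
        exact hR r (Finset.mem_filter.mp hr).1 s (Finset.mem_filter.mp hs).1
      · intro r hr
        have hr' := Finset.mem_filter.mp hr
        rw [Polynomial.eval_sub, Polynomial.taylor_eval]
        have := dni_sub (g.eval ((r : ℝ) + h)) (g.eval (r : ℝ))
        have h3 := hδ r hr'.1
        have h4 := hδ _ hr'.2
        push_cast at h4
        linarith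
    have hd : d + 1 ≤ 2 ^ d := Nat.lt_two_pow_self
    calc R.card ^ (2 ^ (d + 1)) = (∑ h ∈ I, (S h).card) ^ ((2 ^ d - 1) + 1) := by
          rw [← h1, ← pow_mul]; congr 1; rw [Nat.sub_add_cancel (by omega), pow_succ]; ring
      _ ≤ I.card ^ (2 ^ d - 1) * ∑ h ∈ I, (S h).card ^ ((2 ^ d - 1) + 1) :=
          pow_sum_le_card_mul_sum_pow (fun _ _ => Nat.zero_le _) _
      _ = (2 * Q + 1) ^ (2 ^ d - 1) * ∑ h ∈ I, (S h).card ^ (2 ^ d) := by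
          rw [cardIcc, Nat.sub_add_cancel (by omega)]
      _ ≤ (2 * Q + 1) ^ (2 ^ d - 1) * ∑ h ∈ I, (2 * Q + 1) ^ (2 ^ d - (d + 1)) *
        T Q (d + 1) ((((d + 2).factorial : ℝ) * g.coeff (d + 2)) * h) (2 ^ (d + 2) * δ) := by
          gcongr with h hh
          exact h2 h hh
      _ = _ := by
          rw [← Finset.mul_sum, ← mul_assoc, ← pow_add]
          congr 2
          rw [pow_succ]; omega

lemma T_trivial (Q d : ℕ) : ∀ (β η : ℝ), T Q d β η ≤ (2 * Q + 1) ^ d := by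
  induction d with
  | zero => intro β η; simp only [T]; split_ifs <;> simp
  | succ d ih =>
    intro β η
    simp only [T]
    calc _ ≤ ∑ h ∈ Finset.Icc (-(Q : ℤ)) Q, (2 * Q + 1) ^ d := Finset.sum_le_sum fun _ _ => ih _ _
      _ = _ := by rw [Finset.sum_const, cardIcc, smul_eq_mul, pow_succ]; ring

noncomputable def V (X : ℕ) (β η : ℝ) : Finset ℤ :=
  (Finset.Icc (-(X : ℤ)) X).filter (fun m => m ≠ 0 ∧ distNearestInt (β * m) ≤ η)

lemma intdiv_card (n : ℤ) (hn : n ≠ 0) (I : Finset ℤ) :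
    (I.filter (fun h => h ∣ n)).card ≤ 2 * n.natAbs.divisors.card := by
  calc _ ≤ ((n.natAbs.divisors).image (fun d : ℕ => (d : ℤ)) ∪
      (n.natAbs.divisors).image (fun d : ℕ => -(d : ℤ))).card := by
        apply Finset.card_le_card
        intro h hh
        have hd := (Finset.mem_filter.mp hh).2
        have hm : h.natAbs ∈ n.natAbs.divisors := by
          simp [hn, Int.natAbs_dvd_natAbs, hd]
        rw [Finset.mem_union, Finset.mem_image, Finset.mem_image]
        rcases Int.natAbs_eq h with e | e
        · exact Or.inl ⟨_, hm, e.symm⟩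
        · exact Or.inr ⟨_, hm, e.symm⟩
    _ ≤ _ := by
        refine (Finset.card_union_le _ _).trans ?_
        rw [two_mul]
        exact add_le_add Finset.card_image_le Finset.card_image_le

lemma T_bound (Q B : ℕ) (d : ℕ) : ∀ (β η : ℝ),
    (∀ n : ℕ, n ≠ 0 → n ≤ Q ^ d → n.divisors.card ≤ B) → 
    (2 * Q + 1) * T Q d β η ≤ d * (2 * Q + 1) ^ d + (2 * Q + 1) * ((2 * B) ^ d * (V (Q ^ d) β η).card) := by
  induction d with
  | zero =>
    intro β η hB
    simp only [T, zero_mul, zero_add, pow_zero, one_mul]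
    gcongr
    split_ifs with h
    · rw [Nat.one_le_iff_ne_zero, Finset.card_ne_zero]
      exact ⟨1, by simp [V, h]⟩
    · simp
  | succ d ih =>
    intro β η hB
    rcases Nat.eq_zero_or_pos Q with hQ | hQ
    · subst hQ
      simp [T]
      have := T_trivial 0 d 0 η
      simp at this
      omega
    have hB' : ∀ n : ℕ, n ≠ 0 → n ≤ Q ^ d → n.divisors.card ≤ B := fun n hn h =>
      hB n hn (h.trans (Nat.pow_le_pow_right hQ (by omega)))
    set I := Finset.Icc (-(Q : ℤ)) Q with hI
    have h0 : (0 : ℤ) ∈ I := by simp [hI]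
    have hsum : ∑ h ∈ I.erase 0, (V (Q ^ d) (β * h) η).card ≤ 2 * B * (V (Q ^ (d + 1)) β η).card := by
      rw [← Finset.card_sigma]
      have hmaps : Set.MapsTo (fun p : (_ : ℤ) × ℤ => p.1 * p.2)
          ((I.erase 0).sigma fun h => V (Q ^ d) (β * h) η : Finset _) (V (Q ^ (d + 1)) β η : Finset ℤ) := by
        rintro ⟨h, m⟩ hp
        simp only [Finset.coe_sigma, Set.mem_sigma_iff, Finset.mem_coe, Finset.mem_erase, V,
          Finset.mem_filter, Finset.mem_Icc, hI] at hp ⊢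
        obtain ⟨⟨hne, hh⟩, hm, hmne, hd⟩ := hp
        refine ⟨?_, mul_ne_zero hne hmne, ?_⟩
        · rw [← abs_le] at hh hm ⊢
          rw [abs_mul, pow_succ, mul_comm]
          push_cast at hm ⊢
          gcongr
        · convert hd using 2; push_cast; ring
      rw [Finset.card_eq_sum_card_fiberwise hmaps]
      calc _ ≤ ∑ n ∈ V (Q ^ (d + 1)) β η, 2 * B := by
            apply Finset.sum_le_sum
            intro n hn
            simp only [V, Finset.mem_filter, Finset.mem_Icc] at hn
            refine le_trans ?_ ((intdiv_card n hn.2.1 I).trans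
              (Nat.mul_le_mul_left 2 (hB n.natAbs (by simpa using hn.2.1) (by zify; push_cast at hn; exact abs_le.mpr hn.1))))
            refine Finset.card_le_card_of_injOn (fun p => p.1) ?_ ?_
            · rintro ⟨h, m⟩ hp
              simp only [Finset.coe_filter, Set.mem_ofPred_eq, Finset.mem_sigma, Finset.mem_erase] at hp ⊢
              exact ⟨hp.1.1.2, m, hp.2.symm⟩
            · rintro ⟨h, m⟩ hp ⟨h', m'⟩ hp' e
              simp only [Finset.coe_filter, Set.mem_ofPred_eq, Finset.mem_sigma, Finset.mem_erase] at hp hp' e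
              subst e
              have : m = m' := mul_left_cancel₀ hp.1.1.1 (hp.2.trans hp'.2.symm)
              subst this; rfl
        _ = _ := by rw [Finset.sum_const, smul_eq_mul, mul_comm]
    have hcard : (I.erase 0).card ≤ 2 * Q + 1 := (Finset.card_le_card (Finset.erase_subset _ _)).trans
      (cardIcc Q).le
    simp only [T]
    rw [← Finset.add_sum_erase I _ h0, mul_add, Finset.mul_sum]
    calc _ ≤ (2 * Q + 1) * (2 * Q + 1) ^ d + ∑ h ∈ I.erase 0, (d * (2 * Q + 1) ^ d + 
          (2 * Q + 1) * ((2 * B) ^ d * (V (Q ^ d) (β * h) η).card)) := by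
          gcongr with h hh
          · exact T_trivial _ _ _ _
          · exact ih _ _ hB'
      _ = (2 * Q + 1) * (2 * Q + 1) ^ d + (I.erase 0).card * (d * (2 * Q + 1) ^ d) +
          (2 * Q + 1) * ((2 * B) ^ d * ∑ h ∈ I.erase 0, (V (Q ^ d) (β * h) η).card) := by
          rw [Finset.sum_add_distrib, Finset.sum_const, smul_eq_mul, ← Finset.mul_sum,
            ← Finset.mul_sum, add_assoc]
      _ ≤ (2 * Q + 1) * (2 * Q + 1) ^ d + (2 * Q + 1) * (d * (2 * Q + 1) ^ d) +
          (2 * Q + 1) * ((2 * B) ^ d * (2 * B * (V (Q ^ (d + 1)) β η).card)) := by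
          gcongr
      _ = _ := by ring

lemma V_card (L X : ℕ) (hL : L ≠ 0) (a F : ℕ) (hF : 0 < F) (hco : Nat.Coprime a F) (η : ℝ)
    (hη : 0 ≤ η) :
    ((V X ((L : ℝ) * ((a : ℝ) / F)) η).card : ℝ) ≤
      (2 * ((L : ℝ) * X / F) + 2) * (2 * (η * F) + 1) := by
  have hFR : (0 : ℝ) < F := by exact_mod_cast hF
  have hFZ : (0 : ℤ) < F := by exact_mod_cast hF
  set G : ℤ := ⌊η * F⌋ with hG
  have hG0 : 0 ≤ G := Int.floor_nonneg.mpr (by positivity)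
  set J : ℤ := (L * X : ℤ) / F with hJ
  have hJ0 : 0 ≤ J := Int.ediv_nonneg (by positivity) hFZ.le
  let β : ℝ := (L : ℝ) * ((a : ℝ) / F)
  have hle : (V X ((L : ℝ) * ((a : ℝ) / F)) η).card ≤
      ((Finset.Icc (-J - 1) J) ×ˢ (Finset.Icc (-G) G)).card := by
    refine Finset.card_le_card_of_injOn
      (fun m : ℤ => ((L * m) / (F : ℤ), L * m * a - F * round (β * m))) ?_ ?_
    · intro m hm
      simp only [V, Finset.coe_filter, Set.mem_ofPred_eq, Finset.mem_Icc] at hm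
      obtain ⟨⟨hm1, hm2⟩, _, hm3⟩ := hm
      simp only [Finset.coe_product, Set.mem_prod, Finset.mem_coe, Finset.mem_Icc]
      refine ⟨⟨?_, ?_⟩, ?_⟩
      · rw [Int.le_ediv_iff_mul_le hFZ]
        have h1 : (L * X : ℤ) < (J + 1) * F := Int.lt_ediv_add_one_mul_self _ hFZ
        nlinarith
      · exact Int.ediv_le_ediv hFZ (by gcongr)
      · rw [← abs_le, hG, Int.le_floor]
        push_cast
        have e : (L : ℝ) * m * a - F * (round (β * m) : ℝ) = (β * m - round (β * m)) * F := by
          simp only [β]; field_simp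
        rw [e, abs_mul, abs_of_pos hFR]
        gcongr
        exact hm3
    · intro m _ m' _ h
      simp only [Prod.mk.injEq] at h
      obtain ⟨h1, h2⟩ := h
      have hdvd : (F : ℤ) ∣ (L * m - L * m') * a := by
        refine ⟨round (β * m) - round (β * m'), ?_⟩
        linear_combination h2
      have hco' : IsCoprime (F : ℤ) (a : ℤ) := (Nat.isCoprime_iff_coprime.mpr hco).symm
      have hd2 := hco'.dvd_of_dvd_mul_right hdvd
      have hmod : (L * m : ℤ) % F = (L * m') % F :=
        ((Int.emod_emod_of_dvd _ dvd_rfl).symm.trans (Int.emod_emod_of_dvd _ dvd_rfl)).trans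
          (Int.emod_eq_emod_iff_emod_sub_eq_zero.mpr (Int.emod_eq_zero_of_dvd hd2))
      have e1 := Int.mul_ediv_add_emod (L * m : ℤ) F
      have e2 := Int.mul_ediv_add_emod (L * m' : ℤ) F
      rw [h1, hmod, e2] at e1
      exact (mul_left_cancel₀ (by exact_mod_cast hL) e1).symm
  rw [Finset.card_product, Int.card_Icc, Int.card_Icc] at hle
  have h1 : (((J + 1 - (-J - 1)).toNat : ℕ) : ℝ) = 2 * J + 2 := by
    have : (((J + 1 - (-J - 1)).toNat : ℕ) : ℤ) = 2 * J + 2 := by omega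
    exact_mod_cast this
  have h2 : (((G + 1 - -G).toNat : ℕ) : ℝ) = 2 * G + 1 := by
    have : (((G + 1 - -G).toNat : ℕ) : ℤ) = 2 * G + 1 := by omega
    exact_mod_cast this
  have hle' : ((V X ((L : ℝ) * ((a : ℝ) / F)) η).card : ℝ) ≤ (2 * J + 2) * (2 * G + 1) := by
    rw [← h1, ← h2]; exact_mod_cast hle
  have hGr : (G : ℝ) ≤ η * F := Int.floor_le _
  have hJr : (J : ℝ) ≤ (L : ℝ) * X / F := by
    rw [le_div_iff₀ hFR]
    have hz : J * F ≤ (L * X : ℤ) := Int.ediv_mul_le (L * X : ℤ) hFZ.ne'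
    exact_mod_cast hz
  have hG0' : (0 : ℝ) ≤ G := by exact_mod_cast hG0
  have hJ0' : (0 : ℝ) ≤ J := by exact_mod_cast hJ0
  refine hle'.trans ?_
  gcongr

lemma poly_bounds (k : ℕ) (hk : 2 ≤ k) (f : Polynomial ℤ) (hdeg : f.natDegree = k)
    (hlead : 0 < f.leadingCoeff) (hpos : ∀ q : ℕ, 1 ≤ q → 1 ≤ f.eval (q : ℤ)) :
    ∃ C : ℕ, 1 ≤ C ∧ ∀ Q q : ℕ, 1 ≤ Q → Q ≤ q → q ≤ 2 * Q →
      f.eval (q : ℤ) ≤ C * (Q : ℤ) ^ k ∧ (Q : ℤ) ^ k ≤ C * f.eval (q : ℤ) := by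
  set A : ℕ := ∑ i ∈ Finset.range k, (f.coeff i).natAbs with hA
  set c : ℕ := f.leadingCoeff.natAbs with hc
  have hcc : (c : ℤ) = f.leadingCoeff := by omega
  have hlow : ∀ q : ℕ, 1 ≤ q → |f.eval (q : ℤ) - c * (q : ℤ) ^ k| ≤ A * (q : ℤ) ^ (k - 1) := by
    intro q hq
    rw [Polynomial.eval_eq_sum_range, hdeg, Finset.sum_range_succ, hcc, Polynomial.leadingCoeff, hdeg,
      add_sub_cancel_right]
    refine (Finset.abs_sum_le_sum_abs _ _).trans ?_
    rw [hA]; push_cast; rw [Finset.sum_mul]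
    apply Finset.sum_le_sum
    intro i hi
    rw [abs_mul, abs_pow, Nat.abs_cast]
    have : i ≤ k - 1 := by have := Finset.mem_range.mp hi; omega
    have hq' : (1 : ℤ) ≤ q := by exact_mod_cast hq
    gcongr
  refine ⟨(c + A) * 2 ^ k + 2 + (2 * A) ^ k, by omega, fun Q q hQ hq1 hq2 => ?_⟩
  have hq : 1 ≤ q := hQ.trans hq1
  have h1 := abs_le.mp (hlow q hq)
  have hfq := hpos q hq
  have hqz : (1 : ℤ) ≤ q := by exact_mod_cast hq
  have hkk : (q : ℤ) ^ k = q ^ (k - 1) * q := by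
    rw [← pow_succ]; congr 1; omega
  have hp0 : (0 : ℤ) < (q : ℤ) ^ (k - 1) := by positivity
  constructor
  · have h2 : f.eval (q : ℤ) ≤ (c + A) * (q : ℤ) ^ k := by nlinarith
    have h3 : (q : ℤ) ^ k ≤ 2 ^ k * (Q : ℤ) ^ k := by
      rw [← mul_pow]; gcongr; exact_mod_cast hq2
    push_cast
    have h4 : (0 : ℤ) ≤ (Q : ℤ) ^ k := by positivity
    have h5 : (0 : ℤ) ≤ (2 * (A : ℤ)) ^ k := by positivity
    calc _ ≤ (c + A : ℤ) * (2 ^ k * (Q : ℤ) ^ k) := h2.trans (by gcongr)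
      _ ≤ _ := by nlinarith [mul_nonneg h5 h4]
  · have h3 : (Q : ℤ) ^ k ≤ (q : ℤ) ^ k := by gcongr
    refine h3.trans ?_
    push_cast
    have h5 : (0 : ℤ) ≤ (2 * (A : ℤ)) ^ k := by positivity
    have h6 : (0 : ℤ) ≤ (c + A : ℤ) * 2 ^ k := by positivity
    rcases le_or_gt (2 * A) q with h | h
    · have h' : 2 * (A : ℤ) ≤ q := by exact_mod_cast h
      have hc1 : (1 : ℤ) ≤ c := by omega
      have : (q : ℤ) ^ k ≤ 2 * f.eval (q : ℤ) := by
        have : (q : ℤ) ^ k ≤ c * (q : ℤ) ^ k := le_mul_of_one_le_left (by positivity) hc1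
        nlinarith
      nlinarith
    · have : (q : ℤ) ^ k ≤ (2 * (A : ℤ)) ^ k := by
        gcongr; exact_mod_cast h.le
      nlinarith

/-- the set of `r` with `x f(r)` near an integer -/
noncomputable def Rset (f : Polynomial ℤ) (x δ : ℝ) (Q : ℕ) : Finset ℤ :=
  (Finset.Icc (Q : ℤ) (2 * Q)).filter
    (fun r => distNearestInt (x * ((f.eval r : ℤ) : ℝ)) ≤ δ)

lemma R_pow_bound (k : ℕ) (hk : 2 ≤ k) (f : Polynomial ℤ) (hdeg : f.natDegree = k)
    (hlead : 0 < f.leadingCoeff) (C1 : ℕ) (ε : ℝ) (hε : 0 < ε) :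
    ∃ M : ℝ, 1 ≤ M ∧ ∀ (Q a F : ℕ) (δ : ℝ), 0 < Q → 0 ≤ δ → 0 < F → Nat.Coprime a F →
      (F : ℝ) ≤ C1 * (Q : ℝ) ^ k → (Q : ℝ) ^ k ≤ C1 * F →
      ((Rset f ((a : ℝ) / F) δ Q).card : ℝ) ^ (2 ^ (k - 1)) ≤
        M * ((Q : ℝ) ^ ((2 : ℝ) ^ (k - 1) - 1 + ε) + (Q : ℝ) ^ ((2 : ℝ) ^ (k - 1) + ε) * δ) := by
  obtain ⟨d, rfl⟩ : ∃ d, k = d + 1 := ⟨k - 1, by omega⟩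
  obtain ⟨D, hD1, hD⟩ := divisor_bound (ε / ((d + 1 : ℕ) : ℝ) ^ 2) (by positivity)
  set c : ℕ := f.leadingCoeff.natAbs with hc
  have hcc : (c : ℤ) = f.leadingCoeff := by omega
  set L : ℕ := (d + 1).factorial * c with hL
  have hL0 : L ≠ 0 := Nat.mul_ne_zero (Nat.factorial_ne_zero _) (by omega)
  set W : ℝ := (2 * D) ^ (d + 1) * ((2 * (L * C1) + 2) * (2 * 2 ^ (d + 1) * C1 + 1)) with hW
  have hW0 : 0 ≤ W := by positivity
  refine ⟨3 ^ (2 ^ d) * ((d + 1) + W) + 1, ?_, ?_⟩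
  · have : 0 ≤ (3 : ℝ) ^ (2 ^ d) * ((d + 1) + W) := by positivity
    linarith
  intro Q a F δ hQ hδ hF hco hF1 hF2
  have hFR : (0 : ℝ) < F := by exact_mod_cast hF
  have hQR : (1 : ℝ) ≤ Q := by exact_mod_cast hQ
  have hQ0 : (0 : ℝ) < Q := by linarith
  simp only [Nat.add_sub_cancel]
  set R := Rset f ((a : ℝ) / F) δ Q with hR
  let g : Polynomial ℝ := Polynomial.C ((a : ℝ) / F) * f.map (Int.castRingHom ℝ)
  have hgdeg : g.natDegree ≤ d + 1 := by
    refine (Polynomial.natDegree_C_mul_le _ _).trans ?_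
    exact Polynomial.natDegree_map_le.trans hdeg.le
  have hgc : ((d + 1).factorial : ℝ) * g.coeff (d + 1) = (L : ℝ) * ((a : ℝ) / F) := by
    have : f.coeff (d + 1) = c := by rw [hcc, Polynomial.leadingCoeff, hdeg]
    simp only [g, Polynomial.coeff_C_mul, Polynomial.coeff_map, this, hL]
    push_cast; simp; ring
  have hw := weyl Q d g δ R hgdeg ?_ ?_
  rotate_left
  · intro r hr s hs
    have h1 := (Finset.mem_filter.mp hr).1
    have h2 := (Finset.mem_filter.mp hs).1
    simp only [Finset.mem_Icc] at h1 h2 ⊢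
    omega
  · intro r hr
    have h1 := (Finset.mem_filter.mp hr).2
    have e : g.eval (r : ℝ) = (a : ℝ) / F * ((f.eval r : ℤ) : ℝ) := by
      simp only [g, Polynomial.eval_mul, Polynomial.eval_C]
      congr 1
      simp [Polynomial.eval_intCast_map]
    rw [e]; exact h1
  rw [hgc] at hw
  set E : ℝ := D * (Q : ℝ) ^ (ε / ((d + 1 : ℕ) : ℝ)) with hE
  have hE0 : 0 ≤ E := by positivity
  have hB : ∀ n : ℕ, n ≠ 0 → n ≤ Q ^ (d + 1) → n.divisors.card ≤ ⌊E⌋₊ := by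
    intro n hn hnQ
    apply Nat.le_floor
    refine (hD n hn).trans ?_
    rw [hE]
    gcongr
    calc (n : ℝ) ^ (ε / ((d + 1 : ℕ) : ℝ) ^ 2) ≤ ((Q : ℝ) ^ (d + 1)) ^ (ε / ((d + 1 : ℕ) : ℝ) ^ 2) := by
          gcongr; exact_mod_cast hnQ
      _ = _ := by
          rw [← Real.rpow_natCast, ← Real.rpow_mul hQ0.le]; congr 1; field_simp
  have ht := T_bound Q ⌊E⌋₊ (d + 1) ((L : ℝ) * ((a : ℝ) / F)) (2 ^ (d + 1) * δ) hB
  have hv := V_card L (Q ^ (d + 1)) hL0 a F hF hco (2 ^ (d + 1) * δ) (by positivity)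
  set t := T Q (d + 1) ((L : ℝ) * ((a : ℝ) / F)) (2 ^ (d + 1) * δ)
  set v := (V (Q ^ (d + 1)) ((L : ℝ) * ((a : ℝ) / F)) (2 ^ (d + 1) * δ)).card
  have hv' : (v : ℝ) ≤ ((2 * (L * C1) + 2) * (2 * 2 ^ (d + 1) * C1 + 1)) * (1 + (Q : ℝ) ^ (d + 1) * δ) := by
    have h1 : (L : ℝ) * ((Q ^ (d + 1) : ℕ) : ℝ) / F ≤ L * C1 := by
      rw [div_le_iff₀ hFR, mul_assoc]; push_cast; gcongr
    have h2 : 2 * (2 ^ (d + 1) * δ * F) + 1 ≤ (2 * 2 ^ (d + 1) * C1 + 1) * (1 + (Q : ℝ) ^ (d + 1) * δ) := by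
      have h3 : 2 ^ (d + 1) * δ * F ≤ 2 ^ (d + 1) * δ * (C1 * (Q : ℝ) ^ (d + 1)) := by gcongr
      have h4 : 0 ≤ (Q : ℝ) ^ (d + 1) * δ := by positivity
      have h5 : (0 : ℝ) ≤ 2 * 2 ^ (d + 1) * C1 := by positivity
      nlinarith
    refine hv.trans ?_
    rw [mul_assoc _ _ (1 + _)]
    gcongr
  have hBk : (2 * (⌊E⌋₊ : ℝ)) ^ (d + 1) ≤ (2 * D) ^ (d + 1) * (Q : ℝ) ^ ε := by
    calc (2 * (⌊E⌋₊ : ℝ)) ^ (d + 1) ≤ (2 * E) ^ (d + 1) := by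
          gcongr; exact Nat.floor_le hE0
      _ = _ := by
          rw [hE, ← mul_assoc, mul_pow]
          congr 1
          rw [← Real.rpow_natCast, ← Real.rpow_mul hQ0.le]; congr 1; field_simp
  have hwR : (R.card : ℝ) ^ (2 ^ d) ≤ (2 * Q + 1) ^ (2 ^ d - (d + 1)) * t := by exact_mod_cast hw
  have htR : (t : ℝ) ≤ (d + 1) * (2 * Q + 1) ^ d + W * ((Q : ℝ) ^ ε * (1 + (Q : ℝ) ^ (d + 1) * δ)) := by
    have h1 : (2 * (Q : ℝ) + 1) * t ≤ ((d : ℝ) + 1) * (2 * Q + 1) ^ (d + 1) +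
        (2 * Q + 1) * ((2 * (⌊E⌋₊ : ℝ)) ^ (d + 1) * v) := by exact_mod_cast ht
    have h2 : (2 * (⌊E⌋₊ : ℝ)) ^ (d + 1) * v ≤ W * ((Q : ℝ) ^ ε * (1 + (Q : ℝ) ^ (d + 1) * δ)) := by
      calc _ ≤ ((2 * D) ^ (d + 1) * (Q : ℝ) ^ ε) *
            (((2 * (L * C1) + 2) * (2 * 2 ^ (d + 1) * C1 + 1)) * (1 + (Q : ℝ) ^ (d + 1) * δ)) := by gcongr
        _ = _ := by rw [hW]; ring
    have h3 : (2 * (Q : ℝ) + 1) * t ≤ (2 * Q + 1) * ((d + 1) * (2 * Q + 1) ^ d + (2 * (⌊E⌋₊ : ℝ)) ^ (d + 1) * v) := by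
      refine h1.trans (le_of_eq ?_); ring
    have h4 := le_of_mul_le_mul_left h3 (by positivity)
    linarith
  have hd : d + 1 ≤ 2 ^ d := Nat.lt_two_pow_self
  have h3Q : 2 * (Q : ℝ) + 1 ≤ 3 * Q := by linarith
  have e1 : (3 * (Q : ℝ)) ^ (2 ^ d - (d + 1)) * (3 * (Q : ℝ)) ^ (d + 1) = 3 ^ (2 ^ d) * (Q : ℝ) ^ (2 ^ d) := by
    rw [← pow_add, Nat.sub_add_cancel hd, mul_pow]
  set P : ℝ := (3 * (Q : ℝ)) ^ (2 ^ d - (d + 1)) with hP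
  have hP0 : 0 ≤ P := by positivity
  set Y : ℝ := (Q : ℝ) ^ (2 ^ d) with hY
  have hY0 : 0 < Y := by positivity
  have r2 : (Q : ℝ) ^ ((2 : ℝ) ^ d + ε) = Y * (Q : ℝ) ^ ε := by
    rw [Real.rpow_add hQ0, hY, ← Real.rpow_natCast (Q : ℝ) (2 ^ d)]; push_cast; rfl
  have r1 : (Q : ℝ) ^ ((2 : ℝ) ^ d - 1 + ε) = Y * (Q : ℝ) ^ ε / Q := by
    rw [← r2, show (2 : ℝ) ^ d - 1 + ε = (2 : ℝ) ^ d + ε - 1 by ring, Real.rpow_sub_one hQ0.ne']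
  have hQε : 1 ≤ (Q : ℝ) ^ ε := Real.one_le_rpow hQR hε.le
  rw [r1, r2]
  set U : ℝ := (Q : ℝ) ^ ε with hU
  -- `P * Q^(d+1) ≤ 3^(2^d) * Y`
  have p1 : P * (Q : ℝ) ^ (d + 1) ≤ 3 ^ (2 ^ d) * Y := by
    rw [← e1]; gcongr; linarith
  have p2 : P * (3 * (Q : ℝ)) ^ d ≤ 3 ^ (2 ^ d) * (Y / Q) := by
    have : P * (3 * (Q : ℝ)) ^ d = (3 ^ (2 ^ d) * Y) / (3 * Q) := by
      rw [eq_div_iff (by positivity), ← e1]; ring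
    rw [this, mul_div_assoc]
    gcongr
    linarith
  have p3 : P ≤ 3 ^ (2 ^ d) * (Y / Q) := by
    refine le_trans ?_ p2
    exact le_mul_of_one_le_right hP0 (one_le_pow₀ (by linarith))
  calc (R.card : ℝ) ^ (2 ^ d) ≤ P * ((d + 1) * (3 * Q) ^ d + W * (U * (1 + (Q : ℝ) ^ (d + 1) * δ))) := by
        refine hwR.trans ?_
        refine mul_le_mul (by rw [hP]; gcongr) (htR.trans ?_) (by positivity) hP0
        gcongr
    _ = (d + 1) * (P * (3 * Q) ^ d) + W * U * P + W * U * δ * (P * (Q : ℝ) ^ (d + 1)) := by ring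
    _ ≤ (d + 1) * (3 ^ (2 ^ d) * (Y / Q)) * U + W * U * (3 ^ (2 ^ d) * (Y / Q)) + W * U * δ * (3 ^ (2 ^ d) * Y) := by
        have h7 : ((d : ℝ) + 1) * (P * (3 * Q) ^ d) ≤ (d + 1) * (3 ^ (2 ^ d) * (Y / Q)) * U := by
          refine le_trans ?_ (le_mul_of_one_le_right (by positivity) hQε)
          gcongr
        gcongr
    _ = 3 ^ (2 ^ d) * ((d + 1) + W) * (Y * U / Q) + 3 ^ (2 ^ d) * W * (Y * U * δ) := by
        field_simp
    _ ≤ 3 ^ (2 ^ d) * ((d + 1) + W) * (Y * U / Q) + 3 ^ (2 ^ d) * ((d + 1) + W) * (Y * U * δ) := by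
        have h8 : W ≤ (d + 1) + W := by
          have : (0 : ℝ) ≤ d + 1 := by positivity
          linarith
        gcongr
    _ ≤ (3 ^ (2 ^ d) * ((d + 1) + W) + 1) * (Y * U / Q + Y * U * δ) := by
        have : 0 ≤ Y * U / Q + Y * U * δ := by positivity
        linarith

lemma mem_farey_s11 {f : Polynomial ℤ} {Q : ℕ} {y : ℚ} (hy : y ∈ fareySetPoly f Q) :
    ∃ r : ℕ, Q ≤ r ∧ r ≤ 2 * Q ∧ ∃ b : ℕ, 1 ≤ b ∧ b < (f.eval (r : ℤ)).toNat ∧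
      Int.gcd (b : ℤ) (f.eval (r : ℤ)) = 1 ∧ (b : ℚ) / ((f.eval (r : ℤ) : ℤ) : ℚ) = y := by
  simp only [fareySetPoly, Finset.mem_biUnion, Finset.mem_image, Finset.mem_Icc,
    Finset.bind_def, Finset.pure_def, Finset.mem_sup, Finset.mem_singleton,
    Finset.mem_filter, Finset.mem_Ico] at hy
  obtain ⟨r, ⟨hr1, hr2⟩, b', ⟨b, ⟨⟨hb1, hb2⟩, hg⟩, rfl⟩, rfl⟩ := hy
  exact ⟨r, hr1, hr2, b, hb1, hb2, hg, rfl⟩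

lemma count_le (f : Polynomial ℤ) (hpos : ∀ q : ℕ, 1 ≤ q → 1 ≤ f.eval (q : ℤ)) (k C1 : ℕ)
    (Q N : ℕ) (hQ : 0 < Q) (hN : 0 < N) (hQN : (Q : ℝ) ^ k ≤ N)
    (hC1 : ∀ q : ℕ, Q ≤ q → q ≤ 2 * Q → f.eval (q : ℤ) ≤ C1 * (Q : ℤ) ^ k)
    (x : ℚ) (hx0 : 0 < x) (hx1 : x < 1) :
    ((fareySetPoly f Q).filter
          (fun y : ℚ => distNearestInt ((x : ℝ) - (y : ℝ)) < 1 / (2 * (N : ℝ)))).card ≤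
      (Rset f (x : ℝ) (C1 * ((Q : ℝ) ^ k / N)) Q).card * (3 * (2 * (C1 + 1) + 1)) := by
  have hNR : (0 : ℝ) < N := by exact_mod_cast hN
  calc _ ≤ ((Rset f (x : ℝ) (C1 * ((Q : ℝ) ^ k / N)) Q ×ˢ
        (Finset.Icc (-1 : ℤ) 1 ×ˢ Finset.Icc (-((C1 + 1 : ℕ) : ℤ)) ((C1 + 1 : ℕ) : ℤ))).image
        (fun p : ℤ × (ℤ × ℤ) => (((p.2.2 + round ((x : ℝ) * ((f.eval p.1 : ℤ) : ℝ)) - p.2.1 * f.eval p.1 : ℤ) : ℚ)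
          / ((f.eval p.1 : ℤ) : ℚ)))).card := ?_
    _ ≤ _ := by
      refine Finset.card_image_le.trans ?_
      rw [Finset.card_product, Finset.card_product, cardIcc]
      simp
  apply Finset.card_le_card
  intro y hy
  obtain ⟨hy1, hy2⟩ := Finset.mem_filter.mp hy
  obtain ⟨r, hr1, hr2, b, hb1, hb2, _, rfl⟩ := mem_farey_s11 hy1
  have hf1 := hpos r (by omega)
  have hf2 := hC1 r hr1 hr2
  set F : ℤ := f.eval (r : ℤ) with hF
  have hbF : (b : ℤ) < F := by omega
  have hFR : (0 : ℝ) < F := by exact_mod_cast hf1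
  have hFC : (F : ℝ) ≤ C1 * (Q : ℝ) ^ k := by exact_mod_cast hf2
  have hbR : (0 : ℝ) < b := by exact_mod_cast hb1
  have hbFR : (b : ℝ) < F := by exact_mod_cast hbF
  have hx0R : (0 : ℝ) < x := by exact_mod_cast hx0
  have hx1R : (x : ℝ) < 1 := by exact_mod_cast hx1
  push_cast at hy2
  have hy0 : (0 : ℝ) < b / F := by positivity
  have hy1 : (b : ℝ) / F < 1 := by rw [div_lt_one hFR]; exact hbFR
  set m : ℤ := round ((x : ℝ) - b / F) with hm
  have hhalf := abs_le.mp (abs_sub_round ((x : ℝ) - b / F))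
  have hm1 : -1 ≤ m := by
    have : (-2 : ℝ) < m := by linarith
    have : -2 < m := by exact_mod_cast this
    omega
  have hm2 : m ≤ 1 := by
    have : (m : ℝ) < 2 := by linarith
    have : m < 2 := by exact_mod_cast this
    omega
  unfold distNearestInt at hy2
  rw [← hm] at hy2
  have hkey : |(x : ℝ) * F - ((b + m * F : ℤ) : ℝ)| ≤ C1 * ((Q : ℝ) ^ k / N) / 2 := by
    have e : (x : ℝ) * F - ((b + m * F : ℤ) : ℝ) = ((x : ℝ) - b / F - m) * F := by
      push_cast; field_simp; ring
    rw [e, abs_mul, abs_of_pos hFR]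
    calc _ ≤ 1 / (2 * (N : ℝ)) * (C1 * (Q : ℝ) ^ k) := by gcongr
      _ = _ := by field_simp
  have hδ0 : 0 ≤ C1 * ((Q : ℝ) ^ k / N) := by positivity
  have hδ1 : C1 * ((Q : ℝ) ^ k / N) ≤ C1 := by
    refine mul_le_of_le_one_right (by positivity) ?_
    rw [div_le_one hNR]; exact hQN
  have hrd := round_le ((x : ℝ) * F) (b + m * F)
  rw [Finset.mem_image]
  refine ⟨((r : ℤ), (m, (b + m * F) - round ((x : ℝ) * F))), ?_, ?_⟩
  · simp only [Finset.mem_product, Rset, Finset.mem_filter, Finset.mem_Icc]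
    refine ⟨⟨⟨by omega, by omega⟩, ?_⟩, ⟨hm1, hm2⟩, ?_⟩
    · unfold distNearestInt
      rw [← hF]
      linarith
    · rw [← abs_le]
      have h1 := abs_sub_round ((x : ℝ) * F)
      have h2 : |((b + m * F - round ((x : ℝ) * F) : ℤ) : ℝ)| ≤ C1 + 1 := by
        have e : ((b + m * F - round ((x : ℝ) * F) : ℤ) : ℝ) =
          ((x : ℝ) * F - round ((x : ℝ) * F)) - ((x : ℝ) * F - ((b + m * F : ℤ) : ℝ)) := by
          push_cast; ring
        rw [e]
        refine (abs_sub _ _).trans ?_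
        linarith
      exact_mod_cast h2
  · simp only [← hF]
    congr 1
    push_cast
    ring

theorem farey_spacing_polynomial_moduli
    (k : ℕ) (hk : 2 ≤ k) (f : Polynomial ℤ) (hdeg : f.natDegree = k)
    (hlead : 0 < f.leadingCoeff) (hpos : ∀ q : ℕ, 1 ≤ q → 1 ≤ f.eval (q : ℤ))
    (ε : ℝ) (hε : 0 < ε) :
    ∃ C : ℝ, 0 < C ∧ ∀ N Q : ℕ, 0 < N → 0 < Q →
      (Q : ℝ) ^ (k : ℝ) ≤ (N : ℝ) → (N : ℝ) ≤ (Q : ℝ) ^ (2 * (k : ℝ)) →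
      ∀ x ∈ fareySetPoly f Q,
      (((fareySetPoly f Q).filter
          (fun y : ℚ => distNearestInt ((x : ℝ) - (y : ℝ)) < 1 / (2 * (N : ℝ)))).card : ℝ)
        ≤ C * ((Q : ℝ) ^ ((k : ℝ) + 1) / (N : ℝ)
               + (Q : ℝ) ^ (1 - 1 / (2 : ℝ) ^ (k - 1) + ε)
               + (Q : ℝ) ^ (1 + (k : ℝ) / (2 : ℝ) ^ (k - 1) + ε)
                 * (N : ℝ) ^ (-(1 : ℝ) / (2 : ℝ) ^ (k - 1))) := by
  obtain ⟨C1, hC1, hC⟩ := poly_bounds k hk f hdeg hlead hpos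
  obtain ⟨M, hM, hMR⟩ := R_pow_bound k hk f hdeg hlead C1 ε hε
  have hC1R : (1 : ℝ) ≤ C1 := by exact_mod_cast hC1
  have hM0 : 0 < M := by linarith
  refine ⟨M * C1 * (3 * (2 * (C1 + 1) + 1)), by positivity, ?_⟩
  intro N Q hN hQ hQN _ x hx
  have hNR : (0 : ℝ) < N := by exact_mod_cast hN
  have hQR : (1 : ℝ) ≤ Q := by exact_mod_cast hQ
  have hQ0 : (0 : ℝ) < Q := by linarith
  rw [Real.rpow_natCast] at hQN
  obtain ⟨q, hq1, hq2, a, ha1, ha2, hco, hxe⟩ := mem_farey_s11 hx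
  have hf1 := hpos q (by omega)
  obtain ⟨hf2, hf3⟩ := hC Q q hQ hq1 hq2
  obtain ⟨F, hF⟩ : ∃ F : ℕ, f.eval (q : ℤ) = F := ⟨(f.eval (q : ℤ)).toNat, by omega⟩
  rw [hF] at hf1 hf2 hf3 ha2 hco hxe
  have hF0 : 0 < F := by omega
  have haF : a < F := by omega
  have hFQ : (0 : ℚ) < F := by exact_mod_cast hF0
  have haQ : (0 : ℚ) < a := by exact_mod_cast ha1
  push_cast at hxe
  have hx0 : 0 < x := by rw [← hxe]; positivity
  have hx1 : x < 1 := by rw [← hxe, div_lt_one hFQ]; exact_mod_cast haF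
  have hxR : (x : ℝ) = (a : ℝ) / F := by rw [← hxe]; push_cast; rfl
  set δ : ℝ := C1 * ((Q : ℝ) ^ k / N) with hδ
  have hδ0 : 0 ≤ δ := by positivity
  have hcount := count_le f hpos k C1 Q N hQ hN hQN (fun q h1 h2 => (hC Q q hQ h1 h2).1) x hx0 hx1
  have hR := hMR Q a F δ hQ hδ0 hF0 (by simpa using hco)
    (by exact_mod_cast hf2) (by exact_mod_cast hf3)
  rw [← hxR] at hR
  rw [← hδ] at hcount
  set R := (Rset f (x : ℝ) δ Q).card
  set κ : ℝ := (2 : ℝ) ^ (k - 1) with hκ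
  have hκ1 : 1 ≤ κ := one_le_pow₀ (by norm_num)
  have hκ0 : 0 < κ := by linarith
  have hi1 : 1 / κ ≤ 1 := by rw [div_le_one hκ0]; exact hκ1
  have hi0 : 0 ≤ 1 / κ := by positivity
  have hroot : ∀ z : ℝ, 1 ≤ z → z ^ (1 / κ) ≤ z := fun z hz => by
    calc z ^ (1 / κ) ≤ z ^ (1 : ℝ) := Real.rpow_le_rpow_of_exponent_le hz hi1
      _ = z := Real.rpow_one z
  have hRb : (R : ℝ) ≤ M * (((Q : ℝ) ^ (κ - 1 + ε)) ^ (1 / κ) + ((Q : ℝ) ^ (κ + ε) * δ) ^ (1 / κ)) := by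
    calc (R : ℝ) = ((R : ℝ) ^ (2 ^ (k - 1))) ^ (1 / κ) := by
          rw [← Real.rpow_natCast, ← Real.rpow_mul (by positivity)]
          push_cast
          rw [← hκ, mul_one_div_cancel hκ0.ne', Real.rpow_one]
      _ ≤ (M * ((Q : ℝ) ^ (κ - 1 + ε) + (Q : ℝ) ^ (κ + ε) * δ)) ^ (1 / κ) := by gcongr
      _ = M ^ (1 / κ) * ((Q : ℝ) ^ (κ - 1 + ε) + (Q : ℝ) ^ (κ + ε) * δ) ^ (1 / κ) := by
          rw [Real.mul_rpow hM0.le (by positivity)]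
      _ ≤ _ := by
          gcongr
          · exact hroot M hM
          · exact Real.rpow_add_le_add_rpow (by positivity) (by positivity) hi0 hi1
  have hεκ : ε * (1 / κ) ≤ ε := mul_le_of_le_one_right hε.le hi1
  have t1 : ((Q : ℝ) ^ (κ - 1 + ε)) ^ (1 / κ) ≤ (Q : ℝ) ^ (1 - 1 / κ + ε) := by
    rw [← Real.rpow_mul hQ0.le]
    apply Real.rpow_le_rpow_of_exponent_le hQR
    have : (κ - 1 + ε) * (1 / κ) = 1 - 1 / κ + ε * (1 / κ) := by field_simp
    linarith
  have t2 : ((Q : ℝ) ^ (κ + ε) * δ) ^ (1 / κ) ≤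
      C1 * ((Q : ℝ) ^ (1 + (k : ℝ) / κ + ε) * (N : ℝ) ^ (-(1 : ℝ) / κ)) := by
    have e : (Q : ℝ) ^ (κ + ε) * δ = C1 * ((Q : ℝ) ^ (κ + ε + k) * (N : ℝ) ^ (-1 : ℝ)) := by
      rw [hδ, Real.rpow_add hQ0 (κ + ε), Real.rpow_natCast, Real.rpow_neg_one]
      field_simp
    rw [e, Real.mul_rpow (by positivity) (by positivity), Real.mul_rpow (by positivity) (by positivity),
      ← Real.rpow_mul hQ0.le, ← Real.rpow_mul hNR.le]
    have e2 : (-1 : ℝ) * (1 / κ) = -1 / κ := by ring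
    rw [e2]
    gcongr
    · exact hroot _ hC1R
    · have : (κ + ε + k) * (1 / κ) = 1 + k / κ + ε * (1 / κ) := by field_simp; ring
      linarith
  set A := (Q : ℝ) ^ (1 - 1 / κ + ε)
  set B := (Q : ℝ) ^ (1 + (k : ℝ) / κ + ε) * (N : ℝ) ^ (-(1 : ℝ) / κ)
  have hA : 0 ≤ A := by positivity
  have hB : 0 ≤ B := by positivity
  have hZ : 0 ≤ (Q : ℝ) ^ ((k : ℝ) + 1) / N := by positivity
  have hRf : (R : ℝ) ≤ M * C1 * ((Q : ℝ) ^ ((k : ℝ) + 1) / N + A + B) := by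
    refine hRb.trans ?_
    rw [mul_assoc]
    gcongr
    nlinarith
  calc _ ≤ (R : ℝ) * (3 * (2 * (C1 + 1) + 1)) := by exact_mod_cast hcount
    _ ≤ (M * C1 * ((Q : ℝ) ^ ((k : ℝ) + 1) / N + A + B)) * (3 * (2 * (C1 + 1) + 1)) := by gcongr
    _ = _ := by ring
end

section
/- Fix a real α > 1. There is a constant C > 0 (depending only on α) such that for every real R ≥ 1 and every positive integer t with t ≤ R^{1/6}, the set S_{α,t}(R) = { ⌊j^α⌋/t : j ∈ ℕ, R < ⌊j^α⌋ ≤ 2R, t divides ⌊j^α⌋ } satisfies E⁺(S_{α,t}(R)) ≤ C · ( R^{3/α}/t³ + R^{3/2} ), where E⁺ denotes the additive energy. -/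
open scoped BigOperators Classical

/-- The set `S_{α,t}(R) = { ⌊j^α⌋/t : j ∈ ℕ, R < ⌊j^α⌋ ≤ 2R, t ∣ ⌊j^α⌋ }`
realised as a finite set of rationals. -/
noncomputable def PSdivSet (α : ℝ) (t : ℕ) (R : ℝ) : Finset ℚ :=
  (((Finset.range (Nat.ceil ((2 * R + 1) ^ (1 / α)) + 1)).image
      (fun j : ℕ => (Nat.floor ((j : ℝ) ^ α) : ℕ))).filter
    (fun q : ℕ => R < (q : ℝ) ∧ (q : ℝ) ≤ 2 * R ∧ t ∣ q)).image
    (fun q : ℕ => (q : ℚ) / (t : ℚ))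

/-- The additive energy `E⁺(S)` of a finite set of rationals. -/
def addEnergyQ (S : Finset ℚ) : ℕ :=
  ((S ×ˢ S ×ˢ S ×ˢ S).filter fun x => x.1 + x.2.1 = x.2.2.1 + x.2.2.2).card


/-- `ee x = exp(2πix)`. -/
noncomputable def ee (x : ℝ) : ℂ := Complex.exp (Complex.I * ((2 * Real.pi * x : ℝ) : ℂ))

lemma ee_add (x y : ℝ) : ee (x + y) = ee x * ee y := by
  unfold ee
  rw [← Complex.exp_add]
  congr 1
  push_cast
  ring

lemma norm_ee (x : ℝ) : ‖ee x‖ = 1 := by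
  unfold ee
  rw [mul_comm]
  exact Complex.norm_exp_ofReal_mul_I _

lemma ee_int (n : ℤ) : ee n = 1 := by
  unfold ee
  rw [Complex.exp_eq_one_iff]
  refine ⟨n, ?_⟩
  push_cast
  ring

lemma ee_sub_int (x : ℝ) (n : ℤ) : ee (x - n) = ee x := by
  have h := ee_add (x - n) n
  rw [ee_int, mul_one, sub_add_cancel] at h
  exact h.symm

lemma ee_conj (x : ℝ) : (starRingEnd ℂ) (ee x) = ee (-x) := by
  unfold ee
  rw [← Complex.exp_conj]
  congr 1
  rw [map_mul, Complex.conj_I, Complex.conj_ofReal]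
  push_cast
  ring

lemma ee_re (x : ℝ) : (ee x).re = Real.cos (2 * Real.pi * x) := by
  unfold ee
  rw [mul_comm, Complex.exp_ofReal_mul_I_re]

lemma norm_ee_sub_one_le (x : ℝ) : ‖ee x - 1‖ ≤ 2 * Real.pi * |x| := by
  unfold ee
  refine (Real.norm_exp_I_mul_ofReal_sub_one_le).trans ?_
  rw [Real.norm_eq_abs, abs_mul, abs_of_pos (by positivity)]

lemma le_norm_ee_sub_one (x : ℝ) (hx : |x| ≤ 1 / 2) : 4 * |x| ≤ ‖ee x - 1‖ := by
  unfold ee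
  rw [Complex.norm_exp_I_mul_ofReal_sub_one, norm_mul, Real.norm_eq_abs, Real.norm_eq_abs]
  have hp := Real.pi_pos
  have h := Real.mul_abs_le_abs_sin (x := 2 * Real.pi * x / 2) (by
    rw [abs_div, abs_mul, abs_of_pos (by positivity : (0:ℝ) < 2 * Real.pi)]
    norm_num
    nlinarith)
  have h2 : |2 * Real.pi * x / 2| = Real.pi * |x| := by
    rw [abs_div, abs_mul, abs_of_pos (by positivity : (0:ℝ) < 2 * Real.pi)]
    norm_num
    ring
  rw [h2] at h
  have h3 : 2 / Real.pi * (Real.pi * |x|) = 2 * |x| := by field_simp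
  rw [h3] at h
  norm_num
  linarith

lemma norm_ee_sub (x y : ℝ) : ‖ee x - ee y‖ ≤ 2 * Real.pi * |x - y| := by
  have h : ee x - ee y = ee y * (ee (x - y) - 1) := by
    rw [mul_sub, ← ee_add, mul_one]; congr 2; ring
  rw [h, norm_mul, norm_ee, one_mul]
  exact norm_ee_sub_one_le _

lemma w_diff (x y : ℝ) (hx : |x| ≤ 1 / 2) (hy : |y| ≤ 1 / 2) (hxy : x ≤ y) (hs : 0 < x * y) :
    ‖(ee x - 1)⁻¹ - (ee y - 1)⁻¹‖ ≤ Real.pi / 8 * (x⁻¹ - y⁻¹) := by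
  have hx0 : x ≠ 0 := by rintro rfl; simp at hs
  have hy0 : y ≠ 0 := by rintro rfl; simp at hs
  have h1 := le_norm_ee_sub_one x hx
  have h2 := le_norm_ee_sub_one y hy
  have hx1 := abs_pos.mpr hx0
  have hy1 := abs_pos.mpr hy0
  have n1 : ee x - 1 ≠ 0 := by intro h; rw [h, norm_zero] at h1; linarith
  have n2 : ee y - 1 ≠ 0 := by intro h; rw [h, norm_zero] at h2; linarith
  have e1 : (ee x - 1)⁻¹ - (ee y - 1)⁻¹ = (ee y - ee x) / ((ee x - 1) * (ee y - 1)) := by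
    field_simp; ring
  rw [e1, norm_div, norm_mul]
  have h3 := norm_ee_sub y x
  rw [abs_of_nonneg (by linarith)] at h3
  have h4 : 16 * (x * y) ≤ ‖ee x - 1‖ * ‖ee y - 1‖ := by
    calc 16 * (x * y) = (4 * |x|) * (4 * |y|) := by
          rw [← abs_of_pos hs, abs_mul]; ring
      _ ≤ _ := by gcongr
  calc ‖ee y - ee x‖ / (‖ee x - 1‖ * ‖ee y - 1‖)
      ≤ (2 * Real.pi * (y - x)) / (16 * (x * y)) := by
        have : 0 ≤ 2 * Real.pi * (y - x) := le_trans (norm_nonneg _) h3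
        gcongr
    _ = _ := by field_simp; ring

lemma w_bound (x θ : ℝ) (hθ : 0 < θ) (hx : |x| ≤ 1 / 2) (hx1 : θ ≤ |x|) :
    ‖(ee x - 1)⁻¹‖ ≤ 1 / (4 * θ) := by
  rw [norm_inv, ← one_div]
  have := le_norm_ee_sub_one x hx
  apply one_div_le_one_div_of_le <;> linarith

/-- Kusmin–Landau. -/
lemma kusmin (F : ℕ → ℝ) (p q : ℕ) (θ : ℝ) (hθ : 0 < θ)
    (hmono : ∀ n, p ≤ n → n + 1 < q → F (n + 1) - F n ≤ F (n + 2) - F (n + 1))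
    (hs : (∀ n, p ≤ n → n < q → θ ≤ F (n + 1) - F n ∧ F (n + 1) - F n ≤ 1 / 2) ∨
      (∀ n, p ≤ n → n < q → F (n + 1) - F n ≤ -θ ∧ -(1 / 2) ≤ F (n + 1) - F n)) :
    ‖∑ n ∈ Finset.Ico p q, ee (F n)‖ ≤ 1 / θ := by
  rcases le_or_gt q p with hpq | hpq
  · rw [Finset.Ico_eq_empty_of_le hpq]; simp; positivity
  set G : ℕ → ℝ := fun n => F (n + 1) - F n with hG
  have hG1 : ∀ n, p ≤ n → n < q → |G n| ≤ 1 / 2 ∧ θ ≤ |G n| := by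
    intro n h1 h2
    rcases hs with h | h
    · have := h n h1 h2
      rw [abs_of_pos (by simp only [hG]; linarith)]; simp only [hG]; constructor <;> linarith
    · have := h n h1 h2
      rw [abs_of_neg (by simp only [hG]; linarith)]; simp only [hG]; constructor <;> linarith
  have hprod : ∀ n m, p ≤ n → n < q → p ≤ m → m < q → 0 < G n * G m := by
    intro n m h1 h2 h3 h4
    rcases hs with h | h
    · have a := h n h1 h2
      have b := h m h3 h4
      apply mul_pos <;> simp only [hG] <;> linarith
    · have a := h n h1 h2
      have b := h m h3 h4
      apply mul_pos_of_neg_of_neg <;> simp only [hG] <;> linarith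
  set w : ℕ → ℂ := fun n => (ee (G n) - 1)⁻¹ with hw
  have hE : ∀ n, p ≤ n → n < q → ee (F n) = w n * ee (F (n + 1)) - w n * ee (F n) := by
    intro n h1 h2
    have a := hG1 n h1 h2
    have h3 := le_norm_ee_sub_one (G n) a.1
    have n1 : ee (G n) - 1 ≠ 0 := by intro h; rw [h, norm_zero] at h3; linarith
    have h5 : ee (F (n + 1)) = ee (F n) * ee (G n) := by
      rw [← ee_add]; congr 1; simp only [hG]; ring
    rw [h5]; simp only [hw]; field_simp
  have key : ∀ r, p + 1 ≤ r → r ≤ q →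
      ‖∑ n ∈ Finset.Ico p r, ee (F n) - w (r - 1) * ee (F r)‖ ≤
        1 / (4 * θ) + Real.pi / 8 * ((G p)⁻¹ - (G (r - 1))⁻¹) := by
    intro r hr
    induction r, hr using Nat.le_induction with
    | base =>
      intro h
      have a := hG1 p le_rfl (by omega)
      rw [Nat.Ico_succ_singleton, Finset.sum_singleton]
      simp only [Nat.add_sub_cancel, sub_self, mul_zero, add_zero]
      have h2 : ee (F p) - w p * ee (F (p + 1)) = - (w p * ee (F p)) := by
        linear_combination hE p le_rfl (by omega)
      rw [h2, norm_neg, norm_mul, norm_ee, mul_one]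
      exact w_bound _ _ hθ a.1 a.2
    | succ r hr ih =>
      intro h
      have ih := ih (by omega)
      obtain ⟨s, rfl⟩ : ∃ s, r = s + 1 := ⟨r - 1, by omega⟩
      simp only [Nat.add_sub_cancel] at ih ⊢
      rw [Finset.sum_Ico_succ_top (by omega)]
      have h2 : ∑ n ∈ Finset.Ico p (s + 1), ee (F n) + ee (F (s + 1))
          - w (s + 1) * ee (F (s + 1 + 1)) =
          (∑ n ∈ Finset.Ico p (s + 1), ee (F n) - w s * ee (F (s + 1)))
            + (w s - w (s + 1)) * ee (F (s + 1)) := by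
        linear_combination hE (s + 1) (by omega) (by omega)
      rw [h2]
      refine (norm_add_le _ _).trans ?_
      rw [norm_mul, norm_ee, mul_one]
      have a := hG1 s (by omega) (by omega)
      have b := hG1 (s + 1) (by omega) (by omega)
      have := w_diff (G s) (G (s + 1)) a.1 b.1 (hmono s (by omega) (by omega))
        (hprod _ _ (by omega) (by omega) (by omega) (by omega))
      simp only [hw]
      linarith
  have h1 := key q (by omega) le_rfl
  have a := hG1 (q - 1) (by omega) (by omega)
  have h2 := w_bound _ _ hθ a.1 a.2
  have h3 : (G p)⁻¹ - (G (q - 1))⁻¹ ≤ 1 / θ := by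
    rcases hs with h | h
    · have a := h p le_rfl hpq
      have b := h (q - 1) (by omega) (by omega)
      have c : (G p)⁻¹ ≤ 1 / θ := by
        rw [← one_div]; exact one_div_le_one_div_of_le hθ a.1
      have d : 0 < (G (q - 1))⁻¹ := inv_pos.mpr (lt_of_lt_of_le hθ b.1)
      linarith
    · have a := h p le_rfl hpq
      have b := h (q - 1) (by omega) (by omega)
      have c : -(G (q - 1))⁻¹ ≤ 1 / θ := by
        rw [← one_div, ← one_div_neg_eq_neg_one_div]
        exact one_div_le_one_div_of_le hθ (by simp only [hG]; linarith [b.1])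
      have d : (G p)⁻¹ < 0 := inv_lt_zero.mpr (lt_of_le_of_lt a.1 (by linarith))
      linarith
  have h4 : ∑ n ∈ Finset.Ico p q, ee (F n) =
      (∑ n ∈ Finset.Ico p q, ee (F n) - w (q - 1) * ee (F q)) + w (q - 1) * ee (F q) := by ring
  rw [h4]
  refine (norm_add_le _ _).trans ?_
  rw [norm_mul, norm_ee, mul_one]
  have h5 : 1 / (4 * θ) = 1 / 4 * (1 / θ) := by field_simp
  have h6 : 0 < 1 / θ := by positivity
  have h7 : Real.pi / 8 * ((G p)⁻¹ - (G (q - 1))⁻¹) ≤ 1 / 2 * (1 / θ) := by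
    calc Real.pi / 8 * ((G p)⁻¹ - (G (q - 1))⁻¹) ≤ Real.pi / 8 * (1 / θ) := by gcongr
      _ ≤ 1 / 2 * (1 / θ) := by
        apply mul_le_mul_of_nonneg_right _ h6.le
        linarith [Real.pi_le_four]
  have h8 : ‖w (q - 1)‖ ≤ 1 / (4 * θ) := h2
  rw [h5] at h1 h8
  linarith

lemma filter_interval (A B : ℕ) (P : ℕ → Prop) [DecidablePred P]
    (hP : ∀ x y z, A ≤ x → z < B → x ≤ y → y ≤ z → P x → P z → P y) :
    ∃ p q, A ≤ p ∧ p ≤ q ∧ q ≤ max A B ∧ (Finset.Ico A B).filter P = Finset.Ico p q := by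
  rcases ((Finset.Ico A B).filter P).eq_empty_or_nonempty with h | h
  · exact ⟨A, A, le_rfl, le_rfl, le_max_left _ _, by simp [h]⟩
  · set S := (Finset.Ico A B).filter P with hS
    have h1 := S.min'_mem h
    have h2 := S.max'_mem h
    have h3 := S.min'_le_max' h
    have h1' := (Finset.mem_filter.mp h1)
    have h2' := (Finset.mem_filter.mp h2)
    rw [Finset.mem_Ico] at h1' h2'
    refine ⟨S.min' h, S.max' h + 1, h1'.1.1, by omega, ?_, ?_⟩
    · have := le_max_right A B
      omega
    · ext y
      constructor
      · intro hy
        have a := S.min'_le y hy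
        have b := S.le_max' y hy
        rw [Finset.mem_Ico]; omega
      · intro hy
        rw [Finset.mem_Ico] at hy
        rw [hS, Finset.mem_filter, Finset.mem_Ico]
        refine ⟨⟨by omega, by omega⟩, hP _ y _ h1'.1.1 h2'.1.2 hy.1 (by omega) h1'.2 h2'.2⟩

lemma growth (g : ℕ → ℝ) (A B : ℕ) (L U : ℝ)
    (h : ∀ n, A ≤ n → n < B → L ≤ g (n + 1) - g n ∧ g (n + 1) - g n ≤ U) (m n : ℕ) (hm : A ≤ m)
    (hmn : m ≤ n) (hn : n ≤ B) :
    ((n : ℝ) - m) * L ≤ g n - g m ∧ g n - g m ≤ ((n : ℝ) - m) * U := by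
  induction n, hmn using Nat.le_induction with
  | base => simp
  | succ n hmn ih =>
    have a := ih (by omega)
    have b := h n (by omega) (by omega)
    push_cast
    constructor <;> linarith [a.1, a.2, b.1, b.2]

/-- contribution of one integer `a` -/
lemma one_fiber (F : ℕ → ℝ) (A B : ℕ) (L U : ℝ) (hL : 0 < L) (hL1 : L ≤ 1)
    (h : ∀ n, A ≤ n → n < B → L ≤ (F (n + 2) - F (n + 1)) - (F (n + 1) - F n) ∧
      (F (n + 2) - F (n + 1)) - (F (n + 1) - F n) ≤ U) (a : ℤ) :
    ‖∑ n ∈ (Finset.Ico A B).filter (fun n => round (F (n + 1) - F n) = a), ee (F n)‖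
      ≤ 5 / √L := by
  set θ := √L with hθdef
  have hθ : 0 < θ := Real.sqrt_pos.mpr hL
  have hθ2 : θ * θ = L := Real.mul_self_sqrt hL.le
  have hθ1 : θ ≤ 1 := by nlinarith
  set g : ℕ → ℝ := fun n => F (n + 1) - F n with hg
  have hgr := growth g A B L U h
  have hmono : ∀ m n, A ≤ m → m ≤ n → n ≤ B → g m ≤ g n := by
    intro m n h1 h2 h3
    have := (hgr m n h1 h2 h3).1
    have h4 : 0 ≤ ((n : ℝ) - m) * L := by
      have : (m : ℝ) ≤ n := by exact_mod_cast h2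
      apply mul_nonneg <;> linarith
    linarith
  have hrm : ∀ x y z, A ≤ x → z < B → x ≤ y → y ≤ z → round (g x) = a → round (g z) = a →
      round (g y) = a := by
    intro x y z h1 h2 h3 h4 h5 h6
    have a1 := hmono x y h1 h3 (by omega)
    have a2 := hmono y z (by omega) h4 (by omega)
    have b1 : round (g x) ≤ round (g y) := by
      rw [round_eq, round_eq]; exact Int.floor_le_floor (by linarith)
    have b2 : round (g y) ≤ round (g z) := by
      rw [round_eq, round_eq]; exact Int.floor_le_floor (by linarith)
    omega
  have hround : ∀ n, round (g n) = a → |g n - a| ≤ 1 / 2 := by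
    intro n hn; rw [← hn]; exact abs_sub_round _
  -- the three parts
  have hsplit : ∑ n ∈ (Finset.Ico A B).filter (fun n => round (g n) = a), ee (F n) =
      ∑ n ∈ (Finset.Ico A B).filter (fun n => round (g n) = a ∧ θ ≤ g n - a), ee (F n) +
      (∑ n ∈ (Finset.Ico A B).filter (fun n => round (g n) = a ∧ g n - a ≤ -θ), ee (F n) +
      ∑ n ∈ (Finset.Ico A B).filter (fun n => round (g n) = a ∧ |g n - a| < θ), ee (F n)) := by
    simp only [Finset.sum_filter]
    rw [← Finset.sum_add_distrib, ← Finset.sum_add_distrib]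
    apply Finset.sum_congr rfl
    intro n _
    by_cases h0 : round (g n) = a
    · by_cases h1 : θ ≤ g n - a
      · have h2 : ¬ (g n - a ≤ -θ) := by linarith
        have h3 : ¬ (|g n - a| < θ) := by rw [abs_lt]; intro h; linarith [h.2]
        simp [h0, h1, h2, h3]
      · by_cases h2 : g n - a ≤ -θ
        · have h3 : ¬ (|g n - a| < θ) := by rw [abs_lt]; intro h; linarith [h.1]
          simp [h0, h1, h2, h3]
        · have h3 : (|g n - a| < θ) := by rw [abs_lt]; constructor <;> linarith
          simp [h0, h1, h2, h3]
    · simp [h0]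
  have hF' : ∀ n : ℕ, ee (F n) = ee (F n - a * n) := by
    intro n
    have := ee_sub_int (F n) (a * n)
    push_cast at this
    exact this.symm
  have hg' : ∀ n : ℕ, (F (n + 1) - a * ((n + 1 : ℕ) : ℝ)) - (F n - a * n) = g n - a := by
    intro n; simp only [hg]; push_cast; ring
  have h1 : ‖∑ n ∈ (Finset.Ico A B).filter (fun n => round (g n) = a ∧ θ ≤ g n - a), ee (F n)‖
      ≤ 1 / θ := by
    obtain ⟨p, q, hp, hpq, hq, hpq'⟩ := filter_interval A B
      (fun n => round (g n) = a ∧ θ ≤ g n - a) (by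
        intro x y z h1 h2 h3 h4 h5 h6
        refine ⟨hrm x y z h1 h2 h3 h4 h5.1 h6.1, ?_⟩
        linarith [h5.2, hmono x y h1 h3 (by omega)])
    have hmem : ∀ n, p ≤ n → n < q → n < B ∧ (round (g n) = a ∧ θ ≤ g n - a) := by
      intro n hn1 hn2
      have : n ∈ Finset.Ico p q := Finset.mem_Ico.mpr ⟨hn1, hn2⟩
      rw [← hpq', Finset.mem_filter, Finset.mem_Ico] at this
      exact ⟨this.1.2, this.2⟩
    rw [hpq', Finset.sum_congr rfl (fun n _ => hF' n)]
    apply kusmin (fun n : ℕ => F n - a * n) p q θ hθ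
    · intro n hn1 hn2
      have e1 := hg' n
      have e2 := hg' (n + 1)
      have := hmono n (n + 1) (by omega) (by omega) (by have := hmem (n + 1) (by omega) hn2; omega)
      linarith
    · left
      intro n hn1 hn2
      obtain ⟨_, c1, c2⟩ := hmem n hn1 hn2
      have e1 := hg' n
      have := abs_le.mp (hround n c1)
      constructor
      · linarith
      · linarith [this.2]
  have h2 : ‖∑ n ∈ (Finset.Ico A B).filter (fun n => round (g n) = a ∧ g n - a ≤ -θ), ee (F n)‖
      ≤ 1 / θ := by
    obtain ⟨p, q, hp, hpq, hq, hpq'⟩ := filter_interval A B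
      (fun n => round (g n) = a ∧ g n - a ≤ -θ) (by
        intro x y z h1 h2 h3 h4 h5 h6
        refine ⟨hrm x y z h1 h2 h3 h4 h5.1 h6.1, ?_⟩
        linarith [h6.2, hmono y z (by omega) h4 (by omega)])
    have hmem : ∀ n, p ≤ n → n < q → n < B ∧ (round (g n) = a ∧ g n - a ≤ -θ) := by
      intro n hn1 hn2
      have : n ∈ Finset.Ico p q := Finset.mem_Ico.mpr ⟨hn1, hn2⟩
      rw [← hpq', Finset.mem_filter, Finset.mem_Ico] at this
      exact ⟨this.1.2, this.2⟩
    rw [hpq', Finset.sum_congr rfl (fun n _ => hF' n)]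
    apply kusmin (fun n : ℕ => F n - a * n) p q θ hθ
    · intro n hn1 hn2
      have e1 := hg' n
      have e2 := hg' (n + 1)
      have := hmono n (n + 1) (by omega) (by omega) (by have := hmem (n + 1) (by omega) hn2; omega)
      linarith
    · right
      intro n hn1 hn2
      obtain ⟨_, c1, c2⟩ := hmem n hn1 hn2
      have e1 := hg' n
      have := abs_le.mp (hround n c1)
      constructor
      · linarith
      · linarith [this.1]
  have h3 : ‖∑ n ∈ (Finset.Ico A B).filter (fun n => round (g n) = a ∧ |g n - a| < θ), ee (F n)‖
      ≤ 3 / θ := by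
    obtain ⟨p, q, hp, hpq, hq, hpq'⟩ := filter_interval A B
      (fun n => round (g n) = a ∧ |g n - a| < θ) (by
        intro x y z h1 h2 h3 h4 h5 h6
        refine ⟨hrm x y z h1 h2 h3 h4 h5.1 h6.1, ?_⟩
        have a1 := hmono x y h1 h3 (by omega)
        have a2 := hmono y z (by omega) h4 (by omega)
        have b1 := abs_lt.mp h5.2
        have b2 := abs_lt.mp h6.2
        rw [abs_lt]; constructor <;> linarith [b1.1, b2.2])
    have hmem : ∀ n, p ≤ n → n < q → n < B ∧ (round (g n) = a ∧ |g n - a| < θ) := by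
      intro n hn1 hn2
      have : n ∈ Finset.Ico p q := Finset.mem_Ico.mpr ⟨hn1, hn2⟩
      rw [← hpq', Finset.mem_filter, Finset.mem_Ico] at this
      exact ⟨this.1.2, this.2⟩
    rw [hpq']
    refine (norm_sum_le _ _).trans ?_
    simp only [norm_ee, Finset.sum_const, Nat.card_Ico, nsmul_eq_mul, mul_one]
    rw [le_div_iff₀ hθ]
    rcases hpq.eq_or_lt with rfl | hlt
    · simp
    · obtain ⟨s, rfl⟩ : ∃ s, q = s + 1 := ⟨q - 1, by omega⟩
      have a1 := hmem p le_rfl hlt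
      have a2 := hmem s (by omega) (by omega)
      have b1 := abs_lt.mp a1.2.2
      have b2 := abs_lt.mp a2.2.2
      have c := (hgr p s hp (by omega) (by omega)).1
      have hc : ((s : ℝ) - p) * θ * θ ≤ 2 * θ := by
        rw [mul_assoc, hθ2]; linarith [b1.1, b2.2]
      have hc' : ((s : ℝ) - p) * θ ≤ 2 := le_of_mul_le_mul_right hc hθ
      rw [Nat.cast_sub (by omega)]
      push_cast
      linarith
  rw [hsplit]
  refine (norm_add_le _ _).trans ?_
  have h4 := norm_add_le
    (∑ n ∈ (Finset.Ico A B).filter (fun n => round (g n) = a ∧ g n - a ≤ -θ), ee (F n))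
    (∑ n ∈ (Finset.Ico A B).filter (fun n => round (g n) = a ∧ |g n - a| < θ), ee (F n))
  have h5 : 5 / θ = 1 / θ + (1 / θ + 3 / θ) := by ring
  linarith

/-- second derivative test -/
lemma second_deriv (F : ℕ → ℝ) (A B : ℕ) (hAB : A ≤ B) (L U : ℝ) (hL : 0 < L) (hL1 : L ≤ 1)
    (h : ∀ n, A ≤ n → n < B → L ≤ (F (n + 2) - F (n + 1)) - (F (n + 1) - F n) ∧
      (F (n + 2) - F (n + 1)) - (F (n + 1) - F n) ≤ U) :
    ‖∑ n ∈ Finset.Ico A B, ee (F n)‖ ≤ (((B : ℝ) - A) * U + 2) * (5 / √L) := by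
  set g : ℕ → ℝ := fun n => F (n + 1) - F n with hg
  have hgr := growth g A B L U h
  have hmono : ∀ m n, A ≤ m → m ≤ n → n ≤ B → g m ≤ g n := by
    intro m n h1 h2 h3
    have := (hgr m n h1 h2 h3).1
    have h4 : 0 ≤ ((n : ℝ) - m) * L := by
      have : (m : ℝ) ≤ n := by exact_mod_cast h2
      apply mul_nonneg <;> linarith
    linarith
  set T := Finset.Icc (round (g A)) (round (g B)) with hT
  have hmaps : ∀ n ∈ Finset.Ico A B, round (g n) ∈ T := by
    intro n hn
    rw [Finset.mem_Ico] at hn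
    rw [hT, Finset.mem_Icc, round_eq, round_eq, round_eq]
    have a1 := hmono A n le_rfl hn.1 (by omega)
    have a2 := hmono n B hn.1 (by omega) le_rfl
    exact ⟨Int.floor_le_floor (by linarith), Int.floor_le_floor (by linarith)⟩
  rw [← Finset.sum_fiberwise_of_maps_to hmaps]
  refine (norm_sum_le _ _).trans ?_
  refine (Finset.sum_le_sum (fun a _ => one_fiber F A B L U hL hL1 h a)).trans ?_
  rw [Finset.sum_const, nsmul_eq_mul]
  apply mul_le_mul_of_nonneg_right _ (by positivity)
  have hAB' := hmono A B le_rfl hAB le_rfl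
  have hr : round (g A) ≤ round (g B) := by
    rw [round_eq, round_eq]; exact Int.floor_le_floor (by linarith)
  have hc : (T.card : ℤ) = round (g B) + 1 - round (g A) := by
    rw [hT, Int.card_Icc, Int.toNat_of_nonneg (by omega)]
  have hc' : (T.card : ℝ) = round (g B) + 1 - round (g A) := by exact_mod_cast hc
  rw [hc']
  have b1 := abs_le.mp (abs_sub_round (g A))
  have b2 := abs_le.mp (abs_sub_round (g B))
  have := (hgr A B le_rfl hAB le_rfl).2
  linarith [b1.1, b1.2, b2.1, b2.2]

lemma pow_second_diff (α : ℝ) (h1 : 1 < α) (h2 : α < 2) (x : ℝ) (hx : 0 < x) :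
    α * (α - 1) * (x + 2) ^ (α - 2) ≤ ((x + 2) ^ α - (x + 1) ^ α) - ((x + 1) ^ α - x ^ α) ∧
    ((x + 2) ^ α - (x + 1) ^ α) - ((x + 1) ^ α - x ^ α) ≤ α * (α - 1) * x ^ (α - 2) := by
  have hd : ∀ y : ℝ, 0 < y → HasDerivAt (fun y : ℝ => (y + 1) ^ α - y ^ α)
      (α * (y + 1) ^ (α - 1) - α * y ^ (α - 1)) y := by
    intro y hy
    have a := (Real.hasDerivAt_rpow_const (x := y) (p := α) (Or.inl hy.ne'))
    have b := ((hasDerivAt_id y).add_const 1).rpow_const (p := α) (Or.inl (by simp; linarith))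
    simp only [id, one_mul] at b
    exact b.sub a
  have hd2 : ∀ y : ℝ, 0 < y → HasDerivAt (fun y : ℝ => α * y ^ (α - 1))
      (α * ((α - 1) * y ^ (α - 2))) y := by
    intro y hy
    have a := (Real.hasDerivAt_rpow_const (x := y) (p := α - 1) (Or.inl hy.ne'))
    have e : α - 1 - 1 = α - 2 := by ring
    rw [e] at a
    exact a.const_mul α
  obtain ⟨c, hc, hc'⟩ := exists_hasDerivAt_eq_slope (fun y : ℝ => (y + 1) ^ α - y ^ α) _
    (show x < x + 1 by linarith)
    (fun y hy => (hd y (by linarith [hy.1])).continuousAt.continuousWithinAt)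
    (fun y hy => hd y (by linarith [hy.1]))
  obtain ⟨z, hz, hz'⟩ := exists_hasDerivAt_eq_slope (fun y : ℝ => α * y ^ (α - 1)) _
    (show c < c + 1 by linarith)
    (fun y hy => (hd2 y (by linarith [hy.1, hc.1])).continuousAt.continuousWithinAt)
    (fun y hy => hd2 y (by linarith [hy.1, hc.1]))
  have e1 : ((x + 2) ^ α - (x + 1) ^ α) - ((x + 1) ^ α - x ^ α) =
      α * (α - 1) * z ^ (α - 2) := by
    simp only [add_sub_cancel_left, div_one] at hc' hz'
    have : x + 1 + 1 = x + 2 := by ring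
    rw [this] at hc'
    linarith
  rw [e1]
  have hzx : x ≤ z := by linarith [hz.1, hc.1]
  have hzx2 : z ≤ x + 2 := by linarith [hz.2, hc.2]
  have hp : 0 ≤ α * (α - 1) := by nlinarith
  constructor
  · exact mul_le_mul_of_nonneg_left
      (Real.rpow_le_rpow_of_nonpos (by linarith) hzx2 (by linarith)) hp
  · exact mul_le_mul_of_nonneg_left
      (Real.rpow_le_rpow_of_nonpos hx hzx (by linarith)) hp

lemma exp_bound (α : ℝ) (h1 : 1 < α) (h2 : α < 2) : ∃ C : ℝ, 0 < C ∧ ∀ R : ℝ, 1 ≤ R →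
    ∀ t : ℕ, 0 < t → (t : ℝ) ≤ R ^ ((1 : ℝ) / 6) → ∀ h : ℕ, 1 ≤ h → h ≤ t →
    ‖∑ n ∈ Finset.Ico ⌈R ^ (1 / α)⌉₊ ⌈3 * R ^ (1 / α)⌉₊, ee (h * ((n : ℝ) ^ α / t))‖
      ≤ C * (√R + R ^ (1 / α) / t) := by
  have h0 : 0 < α * (α - 1) := by nlinarith
  set c2 := α * (α - 1) with hc2
  set c1 := α * (α - 1) * 5 ^ (α - 2) / 2 with hc1
  have hc1p : 0 < c1 := by positivity
  have hc1l : c1 ≤ 1 := by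
    have a : (5 : ℝ) ^ (α - 2) ≤ 1 := Real.rpow_le_one_of_one_le_of_nonpos (by norm_num) (by linarith)
    have b : α * (α - 1) ≤ 2 := by nlinarith
    have c : (0 : ℝ) < 5 ^ (α - 2) := by positivity
    rw [hc1]
    nlinarith
  refine ⟨(15 * c2 + 10) / √c1, by positivity, ?_⟩
  intro R hR t ht htR h hh1 hht
  set N := R ^ (1 / α) with hN
  have hR0 : 0 < R := by linarith
  have hN1 : 1 ≤ N := Real.one_le_rpow hR (by positivity)
  have hN0 : 0 < N := by linarith
  have hNα : N ^ α = R := by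
    rw [hN, ← Real.rpow_mul hR0.le]
    rw [one_div, inv_mul_cancel₀ (by linarith), Real.rpow_one]
  have hNa : N ^ (α - 2) = R / N ^ 2 := by
    rw [Real.rpow_sub hN0, hNα]; norm_num
  have hNR : R ≤ N ^ 2 := by
    rw [← hNα, ← Real.rpow_natCast]
    exact Real.rpow_le_rpow_of_exponent_le hN1 (by push_cast; linarith)
  have ht0 : (0 : ℝ) < t := by exact_mod_cast ht
  have ht1 : (1 : ℝ) ≤ t := by exact_mod_cast ht
  have hh1' : (1 : ℝ) ≤ h := by exact_mod_cast hh1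
  have hht' : (h : ℝ) ≤ t := by exact_mod_cast hht
  have ht3 : (t : ℝ) ^ 3 ≤ R := by
    calc (t : ℝ) ^ 3 ≤ (R ^ ((1 : ℝ) / 6)) ^ 3 := by gcongr
      _ = R ^ ((1 : ℝ) / 2) := by
        rw [← Real.rpow_natCast, ← Real.rpow_mul hR0.le]; norm_num
      _ ≤ R ^ (1 : ℝ) := Real.rpow_le_rpow_of_exponent_le hR (by norm_num)
      _ = R := Real.rpow_one R
  set X := (h : ℝ) / t * (R / N ^ 2) with hX
  have hX0 : 0 < X := by positivity
  have hht1 : (h : ℝ) / t ≤ 1 := (div_le_one ht0).mpr hht'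
  have hRN : R / N ^ 2 ≤ 1 := (div_le_one (by positivity)).mpr hNR
  have hXR : X ≤ R / N ^ 2 := by
    rw [hX]; exact mul_le_of_le_one_left (by positivity) hht1
  have hX1 : X ≤ 1 := hXR.trans hRN
  have hX2 : (t / N) ^ 2 ≤ X := by
    rw [hX, div_pow, div_mul_div_comm, div_le_div_iff₀ (by positivity) (by positivity)]
    have : (t : ℝ) ^ 3 ≤ h * R := by nlinarith
    have h3 : 0 < N ^ 2 := by positivity
    calc (t : ℝ) ^ 2 * (t * N ^ 2) = t ^ 3 * N ^ 2 := by ring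
      _ ≤ h * R * N ^ 2 := by gcongr
  have hsX1 : √X ≤ √R / N := by
    rw [Real.sqrt_le_iff]
    refine ⟨by positivity, ?_⟩
    rw [div_pow, Real.sq_sqrt hR0.le]
    exact hXR
  have hsX2 : t / N ≤ √X := Real.le_sqrt_of_sq_le hX2
  have hsX0 : 0 < √X := Real.sqrt_pos.mpr hX0
  have hAB : ⌈N⌉₊ ≤ ⌈3 * N⌉₊ := Nat.ceil_le_ceil (by linarith)
  have main := second_deriv (fun n : ℕ => h * ((n : ℝ) ^ α / t)) ⌈N⌉₊ ⌈3 * N⌉₊ hAB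
    (c1 * X) (c2 * X) (by positivity) (by nlinarith) (by
      intro n hn1 hn2
      have hn1' : N ≤ n := Nat.ceil_le.mp hn1
      have hn2' : (n : ℝ) < 3 * N := Nat.lt_ceil.mp hn2
      have hps := pow_second_diff α h1 h2 n (by linarith)
      have hht0 : (0 : ℝ) ≤ h / t := by positivity
      push_cast
      have e : (h : ℝ) * (((n : ℝ) + 2) ^ α / t) - h * (((n : ℝ) + 1) ^ α / t) -
          (h * (((n : ℝ) + 1) ^ α / t) - h * ((n : ℝ) ^ α / t)) =
          h / t * ((((n : ℝ) + 2) ^ α - (n + 1) ^ α) - ((n + 1) ^ α - n ^ α)) := by ring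
      rw [e]
      have u1 : (n : ℝ) ^ (α - 2) ≤ R / N ^ 2 := by
        rw [← hNa]; exact Real.rpow_le_rpow_of_nonpos hN0 hn1' (by linarith)
      have u2 : 5 ^ (α - 2) * (R / N ^ 2) ≤ ((n : ℝ) + 2) ^ (α - 2) := by
        rw [← hNa, ← Real.mul_rpow (by norm_num) hN0.le]
        exact Real.rpow_le_rpow_of_nonpos (by linarith) (by linarith) (by linarith)
      constructor
      · calc c1 * X ≤ h / t * (c2 * (5 ^ (α - 2) * (R / N ^ 2))) := by
              have : 0 < c2 * 5 ^ (α - 2) * X := by positivity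
              have e2 : h / t * (c2 * (5 ^ (α - 2) * (R / N ^ 2))) = c2 * 5 ^ (α - 2) * X := by
                rw [hX]; ring
              rw [e2, hc1]
              linarith
          _ ≤ h / t * (c2 * ((n : ℝ) + 2) ^ (α - 2)) := by gcongr
          _ ≤ _ := mul_le_mul_of_nonneg_left hps.1 hht0
      · calc _ ≤ h / t * (c2 * (n : ℝ) ^ (α - 2)) := mul_le_mul_of_nonneg_left hps.2 hht0
          _ ≤ h / t * (c2 * (R / N ^ 2)) := by gcongr
          _ = c2 * X := by rw [hX]; ring)
  refine main.trans ?_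
  have hBA : (⌈3 * N⌉₊ : ℝ) - ⌈N⌉₊ ≤ 3 * N := by
    have a := Nat.ceil_lt_add_one (show 0 ≤ 3 * N by positivity)
    have b := Nat.le_ceil N
    linarith
  rw [Real.sqrt_mul hc1p.le]
  have hsc : 0 < √c1 := Real.sqrt_pos.mpr hc1p
  have hXX : X = √X * √X := (Real.mul_self_sqrt hX0.le).symm
  have hNX : N * √X ≤ √R := by
    rw [le_div_iff₀ hN0] at hsX1; linarith
  have hNX2 : 1 / √X ≤ N / t := by
    rw [div_le_div_iff₀ hsX0 ht0]
    rw [div_le_iff₀ hN0] at hsX2; linarith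
  calc (((⌈3 * N⌉₊ : ℝ) - ⌈N⌉₊) * (c2 * X) + 2) * (5 / (√c1 * √X))
      ≤ (3 * N * (c2 * X) + 2) * (5 / (√c1 * √X)) := by gcongr
    _ = (15 * c2 * (N * √X) + 10 * (1 / √X)) / √c1 := by
        nth_rewrite 1 [hXX]
        field_simp
        ring
    _ ≤ (15 * c2 * √R + 10 * (N / t)) / √c1 := by gcongr
    _ ≤ ((15 * c2 + 10) * (√R + N / t)) / √c1 := by
        gcongr
        have : 0 ≤ √R := Real.sqrt_nonneg R
        have : 0 ≤ N / t := by positivity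
        nlinarith
    _ = _ := by ring

lemma count_bound (S : Finset ℕ) (y : ℕ → ℝ) (t : ℕ) (ht : 0 < t) (E : ℝ)
    (hE : ∀ h : ℕ, 1 ≤ h → h ≤ t → ‖∑ j ∈ S, ee (h * y j)‖ ≤ E) (T : Finset ℕ) (hTS : T ⊆ S)
    (hT : ∀ j ∈ T, ∃ m : ℤ, 0 ≤ y j - m ∧ y j - m < 1 / t) :
    (T.card : ℝ) ≤ 32 * S.card / t + 4 * E := by
  set H := t / 8 + 1 with hH
  have hE0 : 0 ≤ E := (norm_nonneg _).trans (hE 1 le_rfl ht)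
  have ht0 : (0 : ℝ) < t := by exact_mod_cast ht
  have hH0 : (0 : ℝ) < H := by positivity
  have hHt : (t : ℝ) ≤ 8 * H := by
    have : t ≤ 8 * H := by omega
    exact_mod_cast this
  set D : ℕ → ℂ := fun j => ∑ h ∈ Finset.range H, ee (h * y j) with hD
  have lower : ∀ j ∈ T, (H : ℝ) / 2 ≤ ‖D j‖ := by
    intro j hj
    obtain ⟨m, hm0, hm1⟩ := hT j hj
    refine le_trans ?_ (Complex.re_le_norm _)
    rw [hD, Complex.re_sum]
    have : ∀ h ∈ Finset.range H, (1 : ℝ) / 2 ≤ (ee (h * y j)).re := by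
      intro h hh
      rw [Finset.mem_range] at hh
      have e : ee (h * y j) = ee (h * (y j - m)) := by
        have := ee_sub_int (h * y j) (h * m)
        rw [← this]; congr 1; push_cast; ring
      rw [e, ee_re]
      have h8 : (h : ℝ) * 8 ≤ t := by
        have : h * 8 ≤ t := by omega
        exact_mod_cast this
      have hu : (h : ℝ) * (y j - m) ≤ 1 / 8 := by
        calc (h : ℝ) * (y j - m) ≤ h * (1 / t) := by gcongr
          _ ≤ 1 / 8 := by
            rw [mul_one_div, div_le_div_iff₀ ht0 (by norm_num)]; linarith
      have hu0 : 0 ≤ (h : ℝ) * (y j - m) := by positivity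
      have hpi := Real.pi_le_four
      have hpi0 := Real.pi_pos
      have hv : 2 * Real.pi * ((h : ℝ) * (y j - m)) ≤ 1 := by nlinarith
      have hv0 : 0 ≤ 2 * Real.pi * ((h : ℝ) * (y j - m)) := by positivity
      have := Real.one_sub_sq_div_two_le_cos (x := 2 * Real.pi * ((h : ℝ) * (y j - m)))
      nlinarith
    calc (H : ℝ) / 2 = ∑ h ∈ Finset.range H, (1 : ℝ) / 2 := by simp; ring
      _ ≤ _ := Finset.sum_le_sum this
  have expand : ((∑ j ∈ S, ‖D j‖ ^ 2 : ℝ) : ℂ) =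
      ∑ h ∈ Finset.range H, ∑ h' ∈ Finset.range H, ∑ j ∈ S, ee (((h' : ℝ) - h) * y j) := by
    push_cast
    have : ∀ j ∈ S, ((‖D j‖ : ℂ)) ^ 2 =
        ∑ h ∈ Finset.range H, ∑ h' ∈ Finset.range H, ee (((h' : ℝ) - h) * y j) := by
      intro j _
      rw [← Complex.conj_mul', hD, map_sum, Finset.sum_mul_sum]
      apply Finset.sum_congr rfl; intro h _
      apply Finset.sum_congr rfl; intro h' _
      rw [ee_conj, ← ee_add]; congr 1; ring
    rw [Finset.sum_congr rfl this, Finset.sum_comm]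
    apply Finset.sum_congr rfl; intro h _
    rw [Finset.sum_comm]
  have term : ∀ h ∈ Finset.range H, ∀ h' ∈ Finset.range H,
      ‖∑ j ∈ S, ee (((h' : ℝ) - h) * y j)‖ ≤ (if h = h' then (S.card : ℝ) else 0) + E := by
    intro h hh h' hh'
    rw [Finset.mem_range] at hh hh'
    rcases lt_trichotomy h h' with hlt | heq | hgt
    · rw [if_neg (by omega), zero_add]
      have := hE (h' - h) (by omega) (by omega)
      rw [Nat.cast_sub hlt.le] at this
      exact this
    · subst heq
      rw [if_pos rfl]
      refine (norm_sum_le _ _).trans ?_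
      simp only [norm_ee, Finset.sum_const, nsmul_eq_mul, mul_one]
      linarith
    · rw [if_neg (by omega), zero_add]
      have := hE (h - h') (by omega) (by omega)
      rw [Nat.cast_sub hgt.le, ← RCLike.norm_conj, map_sum] at this
      refine le_trans (le_of_eq ?_) this
      congr 1
      apply Finset.sum_congr rfl; intro j _
      rw [ee_conj]; congr 1; ring
  have upper : ∑ j ∈ S, ‖D j‖ ^ 2 ≤ H * S.card + H ^ 2 * E := by
    have h0 : 0 ≤ ∑ j ∈ S, ‖D j‖ ^ 2 := Finset.sum_nonneg (fun _ _ => by positivity)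
    have e1 : ∑ j ∈ S, ‖D j‖ ^ 2 = ‖((∑ j ∈ S, ‖D j‖ ^ 2 : ℝ) : ℂ)‖ := by
      rw [Complex.norm_real, Real.norm_of_nonneg h0]
    rw [e1, expand]
    calc _ ≤ ∑ h ∈ Finset.range H, ∑ h' ∈ Finset.range H,
          ((if h = h' then (S.card : ℝ) else 0) + E) := by
          refine (norm_sum_le _ _).trans (Finset.sum_le_sum fun h hh => ?_)
          exact (norm_sum_le _ _).trans (Finset.sum_le_sum fun h' hh' => term h hh h' hh')
      _ = ∑ h ∈ Finset.range H, ((S.card : ℝ) + H * E) := by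
          apply Finset.sum_congr rfl
          intro h hh
          rw [Finset.sum_add_distrib, Finset.sum_ite_eq, if_pos hh]
          simp
      _ = _ := by simp; ring
  have low2 : (T.card : ℝ) * (H / 2) ^ 2 ≤ ∑ j ∈ S, ‖D j‖ ^ 2 := by
    calc (T.card : ℝ) * (H / 2) ^ 2 = ∑ j ∈ T, ((H : ℝ) / 2) ^ 2 := by simp
      _ ≤ ∑ j ∈ T, ‖D j‖ ^ 2 := Finset.sum_le_sum fun j hj => by
          have := lower j hj
          gcongr
      _ ≤ _ := Finset.sum_le_sum_of_subset_of_nonneg hTS (fun _ _ _ => by positivity)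
  have fin : (T.card : ℝ) * H ≤ 4 * S.card + 4 * E * H := by
    have := low2.trans upper
    have h3 : ((T.card : ℝ) * H) * H ≤ (4 * S.card + 4 * E * H) * H := by nlinarith
    exact le_of_mul_le_mul_right h3 hH0
  have f2 : (T.card : ℝ) ≤ 4 * S.card / H + 4 * E := by
    rw [← sub_le_iff_le_add, le_div_iff₀ hH0]; linarith
  have f3 : 4 * (S.card : ℝ) / H ≤ 32 * S.card / t := by
    rw [div_le_div_iff₀ hH0 ht0]
    have : (0 : ℝ) ≤ S.card := by positivity
    nlinarith
  linarith

lemma energy_le (S : Finset ℚ) : addEnergyQ S ≤ S.card ^ 3 := by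
  unfold addEnergyQ
  have h : (S ×ˢ S ×ˢ S).card = S.card ^ 3 := by
    rw [Finset.card_product, Finset.card_product]; ring
  rw [← h]
  apply Finset.card_le_card_of_injOn (fun x => (x.1, x.2.1, x.2.2.1))
  · intro x hx
    simp only [Finset.coe_filter, Finset.mem_product, Set.mem_setOf_eq] at hx
    simp only [Finset.coe_product, Set.mem_prod, Finset.mem_coe]
    exact ⟨hx.1.1, hx.1.2.1, hx.1.2.2.1⟩
  · rintro ⟨a, b, c, d⟩ hx ⟨a', b', c', d'⟩ hy hxy
    simp only [Finset.coe_filter, Finset.mem_product, Set.mem_setOf_eq] at hx hy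
    simp only [Prod.mk.injEq] at hxy
    obtain ⟨rfl, rfl, rfl⟩ := hxy
    have : d = d' := by linarith [hx.2, hy.2]
    rw [this]

lemma card_bound_large (α : ℝ) (hα : 2 ≤ α) (R : ℝ) (hR : 1 ≤ R) (t : ℕ) :
    ((PSdivSet α t R).card : ℝ) ≤ 5 * √R := by
  have h1 : (PSdivSet α t R).card ≤ ⌈(2 * R + 1) ^ (1 / α)⌉₊ + 1 := by
    unfold PSdivSet
    refine Finset.card_image_le.trans ((Finset.card_filter_le _ _).trans
      (Finset.card_image_le.trans ?_))
    rw [Finset.card_range]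
  have h1' : ((PSdivSet α t R).card : ℝ) ≤ ⌈(2 * R + 1) ^ (1 / α)⌉₊ + 1 := by exact_mod_cast h1
  have h2 := Nat.ceil_lt_add_one (show (0 : ℝ) ≤ (2 * R + 1) ^ (1 / α) by positivity)
  have h3 : (2 * R + 1) ^ (1 / α) ≤ 3 * √R := by
    calc (2 * R + 1) ^ (1 / α) ≤ (9 * R) ^ (1 / α) := by
          apply Real.rpow_le_rpow <;> first | positivity | linarith
      _ ≤ (9 * R) ^ ((1 : ℝ) / 2) := by
          apply Real.rpow_le_rpow_of_exponent_le (by linarith)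
          exact one_div_le_one_div_of_le (by norm_num) hα
      _ = √(9 * R) := by rw [Real.sqrt_eq_rpow]
      _ = 3 * √R := by
          rw [Real.sqrt_mul (by norm_num), show (9 : ℝ) = 3 ^ 2 by norm_num,
            Real.sqrt_sq (by norm_num)]
  have h4 : 1 ≤ √R := Real.one_le_sqrt.mpr hR
  linarith

lemma card_bound (α : ℝ) (hα : 1 < α) : ∃ C : ℝ, 0 < C ∧ ∀ R : ℝ, 1 ≤ R →
    ∀ t : ℕ, 0 < t → (t : ℝ) ≤ R ^ ((1 : ℝ) / 6) →
      ((PSdivSet α t R).card : ℝ) ≤ C * (√R + R ^ (1 / α) / t) := by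
  rcases le_or_gt 2 α with h2 | h2
  · refine ⟨5, by norm_num, ?_⟩
    intro R hR t ht _
    have := card_bound_large α h2 R hR t
    have h3 : 0 ≤ R ^ (1 / α) / t := by positivity
    linarith
  obtain ⟨C, hC, hexp⟩ := exp_bound α hα h2
  refine ⟨96 + 4 * C, by positivity, ?_⟩
  intro R hR t ht htR
  have hE := hexp R hR t ht htR
  set N := R ^ (1 / α) with hN
  have hR0 : 0 < R := by linarith
  have hN1 : 1 ≤ N := Real.one_le_rpow hR (by positivity)
  have hN0 : 0 < N := by linarith
  have hNα : N ^ α = R := by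
    rw [hN, ← Real.rpow_mul hR0.le]
    rw [one_div, inv_mul_cancel₀ (by linarith), Real.rpow_one]
  have ht0 : (0 : ℝ) < t := by exact_mod_cast ht
  set S := Finset.Ico ⌈N⌉₊ ⌈3 * N⌉₊ with hS
  set T := S.filter (fun j : ℕ => t ∣ ⌊(j : ℝ) ^ α⌋₊) with hT
  have hcount := count_bound S (fun j : ℕ => (j : ℝ) ^ α / t) t ht _ hE T (Finset.filter_subset _ _)
    (by
      intro j hj
      rw [hT, Finset.mem_filter] at hj
      obtain ⟨m, hm⟩ := hj.2
      refine ⟨m, ?_⟩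
      have hj0 : (0 : ℝ) ≤ (j : ℝ) ^ α := by positivity
      have a := Nat.floor_le hj0
      have b := Nat.lt_floor_add_one ((j : ℝ) ^ α)
      rw [hm] at a b
      push_cast at a b ⊢
      constructor
      · rw [sub_nonneg, le_div_iff₀ ht0]; linarith
      · rw [sub_lt_iff_lt_add, div_lt_iff₀ ht0, add_mul, one_div, inv_mul_cancel₀ ht0.ne']
        linarith)
  have hsub : PSdivSet α t R ⊆ T.image (fun j : ℕ => ((⌊(j : ℝ) ^ α⌋₊ : ℕ) : ℚ) / (t : ℚ)) := by
    intro x hx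
    unfold PSdivSet at hx
    simp only [Finset.mem_image, Finset.mem_filter] at hx
    obtain ⟨q, ⟨⟨j, _, hjq⟩, hq1, hq2, hq3⟩, hqx⟩ := hx
    rw [Finset.mem_image]
    refine ⟨j, ?_, by rw [hjq]; exact hqx⟩
    have hj0 : (0 : ℝ) ≤ (j : ℝ) ^ α := by positivity
    have a := Nat.floor_le hj0
    have b := Nat.lt_floor_add_one ((j : ℝ) ^ α)
    rw [hjq] at a b
    rw [hT, Finset.mem_filter, hS, Finset.mem_Ico, hjq]
    refine ⟨⟨?_, ?_⟩, hq3⟩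
    · rw [Nat.ceil_le]
      by_contra hlt
      push Not at hlt
      have := Real.rpow_le_rpow (by positivity) hlt.le (show 0 ≤ α by linarith)
      rw [hNα] at this
      linarith
    · rw [Nat.lt_ceil]
      by_contra hlt
      push Not at hlt
      have := Real.rpow_le_rpow (by positivity) hlt (show 0 ≤ α by linarith)
      rw [Real.mul_rpow (by norm_num) hN0.le, hNα] at this
      have h3 : (3 : ℝ) ≤ 3 ^ α := by
        calc (3 : ℝ) = 3 ^ (1 : ℝ) := (Real.rpow_one 3).symm
          _ ≤ 3 ^ α := Real.rpow_le_rpow_of_exponent_le (by norm_num) hα.le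
      nlinarith
  have hcard : ((PSdivSet α t R).card : ℝ) ≤ T.card := by
    exact_mod_cast (Finset.card_le_card hsub).trans Finset.card_image_le
  have hScard : (S.card : ℝ) ≤ 3 * N := by
    rw [hS, Nat.card_Ico, Nat.cast_sub (Nat.ceil_le_ceil (by linarith))]
    have a := Nat.ceil_lt_add_one (show 0 ≤ 3 * N by positivity)
    have b := Nat.le_ceil N
    linarith
  have h5 : 32 * (S.card : ℝ) / t ≤ 96 * (N / t) := by
    rw [← mul_div_assoc]
    gcongr ?_ / _
    linarith
  have h6 : 0 ≤ √R := Real.sqrt_nonneg R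
  nlinarith

theorem energy_PS_divisible (α : ℝ) (hα : 1 < α) :
    ∃ C : ℝ, 0 < C ∧ ∀ R : ℝ, 1 ≤ R → ∀ t : ℕ, 0 < t → (t : ℝ) ≤ R ^ ((1 : ℝ) / 6) →
      (addEnergyQ (PSdivSet α t R) : ℝ)
        ≤ C * (R ^ (3 / α) / (t : ℝ) ^ 3 + R ^ ((3 : ℝ) / 2)) := by
  obtain ⟨C, hC, hcard⟩ := card_bound α hα
  refine ⟨4 * C ^ 3, by positivity, ?_⟩
  intro R hR t ht htR
  have h1 := hcard R hR t ht htR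
  have hR0 : 0 ≤ R := by linarith
  have h2 : (addEnergyQ (PSdivSet α t R) : ℝ) ≤ ((PSdivSet α t R).card : ℝ) ^ 3 := by
    exact_mod_cast energy_le _
  have e1 : R ^ (3 / α) / (t : ℝ) ^ 3 = (R ^ (1 / α) / t) ^ 3 := by
    rw [div_pow, ← Real.rpow_natCast (R ^ (1 / α)), ← Real.rpow_mul hR0]
    congr 2
    push_cast
    ring
  have e2 : R ^ ((3 : ℝ) / 2) = (√R) ^ 3 := by
    rw [Real.sqrt_eq_rpow, ← Real.rpow_natCast, ← Real.rpow_mul hR0]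
    norm_num
  rw [e1, e2]
  have hx : 0 ≤ R ^ (1 / α) / t := by positivity
  have hy : 0 ≤ √R := Real.sqrt_nonneg R
  generalize R ^ (1 / α) / t = x at *
  generalize √R = y at *
  calc _ ≤ ((PSdivSet α t R).card : ℝ) ^ 3 := h2
    _ ≤ (C * (y + x)) ^ 3 := by gcongr
    _ = C ^ 3 * (y + x) ^ 3 := by ring
    _ ≤ C ^ 3 * (4 * (x ^ 3 + y ^ 3)) := by
        gcongr
        nlinarith [mul_nonneg (add_nonneg hx hy) (sq_nonneg (x - y))]
    _ = _ := by ring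
end
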